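/- For integers 1 ≤ m ≤ n and any partition λ, the symmetric function ∏_{i=1}^{n} s_{λ^{[i,n]}} − ∏_{i=1}^{m} s_{λ^{[i,m]}} is Schur nonnegative (the q = 1 case of the Lascoux–Leclerc–Thibon conjecture). -/

import Mathlib

/-- The complete homogeneous symmetric function `h_m` in `N` variables,
with `h_m = 0` for `m < 0`. -/
noncomputable def homog (N : ℕ) (m : ℤ) : MvPolynomial (Fin N) ℤ :=
  if 0 ≤ m then MvPolynomial.hsymm (Fin N) ℤ m.toNat else 0

/-- The skew Schur polynomial `s_{λ/μ}` in `N` variables, given by the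
Jacobi–Trudi determinant `det (h_{λ_i - μ_j - i + j})_{i,j=1}^k`, where the
partitions `lam`, `mu` are recorded 0-indexed (`lam 0 = λ_1`). -/
noncomputable def skewSchur (N k : ℕ) (lam mu : ℕ → ℕ) : MvPolynomial (Fin N) ℤ :=
  Matrix.det (Matrix.of fun i j : Fin k =>
    homog N ((lam i : ℤ) - (mu j : ℤ) - (i : ℤ) + (j : ℤ)))

/-- A symmetric polynomial is Schur nonnegative if it is a linear combination
with nonnegative coefficients of Schur polynomials `s_λ`. -/
def IsSchurNonneg (N : ℕ) (f : MvPolynomial (Fin N) ℤ) : Prop :=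
  ∃ (m : ℕ) (c : Fin m → ℕ) (k : Fin m → ℕ) (lam : Fin m → ℕ → ℕ),
    (∀ i, Antitone (lam i)) ∧ (∀ i j, k i ≤ j → lam i j = 0) ∧
    f = ∑ i, (c i : ℤ) • skewSchur N (k i) (lam i) (fun _ => 0)

section

open Finset

namespace LLT

/-- indicator predicate for membership with a natural number index -/
def has {N : ℕ} (A : Finset (Fin N)) (i : ℕ) : Prop := ∃ h : i < N, (⟨i, h⟩ : Fin N) ∈ A

open Classical in
noncomputable def e {N : ℕ} (A : Finset (Fin N)) (i : ℕ) : ℤ := if has A i then 1 else 0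

noncomputable def F {N : ℕ} (A : Finset (Fin N)) (i : ℕ) : ℤ := ∑ j ∈ range i, e A j

variable {N T : ℕ}

lemma F_zero (A : Finset (Fin N)) : F A 0 = 0 := by simp [F]
lemma F_succ (A : Finset (Fin N)) (i : ℕ) : F A (i+1) = F A i + e A i := by
  simp [F, sum_range_succ]
lemma e_nonneg (A : Finset (Fin N)) (i : ℕ) : 0 ≤ e A i := by unfold e; split_ifs <;> simp
lemma e_le_one (A : Finset (Fin N)) (i : ℕ) : e A i ≤ 1 := by unfold e; split_ifs <;> simp
lemma e_eq_one {A : Finset (Fin N)} {i : ℕ} : e A i = 1 ↔ has A i := by unfold e; split_ifs <;> simp_all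
lemma e_eq_zero {A : Finset (Fin N)} {i : ℕ} : e A i = 0 ↔ ¬ has A i := by
  unfold e; split_ifs <;> simp_all
lemma e_congr {A B : Finset (Fin N)} {i j : ℕ} (h : has A i ↔ has B j) : e A i = e B j := by
  classical
  by_cases h1 : has A i
  · rw [e_eq_one.2 h1, e_eq_one.2 (h.1 h1)]
  · rw [e_eq_zero.2 h1, e_eq_zero.2 (fun h2 => h1 (h.2 h2))]
lemma has_val {A : Finset (Fin N)} (x : Fin N) : has A x ↔ x ∈ A := by
  unfold has; simp
lemma has_ext {A B : Finset (Fin N)} (h : ∀ i, i < N → (has A i ↔ has B i)) : A = B := by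
  ext x; rw [← has_val, ← has_val, h x x.2]
lemma F_N (A : Finset (Fin N)) : F A N = A.card := by
  unfold F
  rw [Finset.sum_range]
  simp only [e, has_val]
  simp
lemma F_nonneg (A : Finset (Fin N)) (i : ℕ) : 0 ≤ F A i := sum_nonneg fun _ _ => e_nonneg _ _
lemma F_le (A : Finset (Fin N)) (i : ℕ) : F A i ≤ i := by
  induction i with
  | zero => simp [F_zero]
  | succ i ih => rw [F_succ]; have := e_le_one A i; push_cast; omega
lemma F_ge (A : Finset (Fin N)) (i : ℕ) (h : N ≤ i) : F A i = A.card := by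
  induction i, h using Nat.le_induction with
  | base => exact F_N A
  | succ i hi ih =>
    rw [F_succ, ih, e_eq_zero.2, add_zero]
    rintro ⟨h, _⟩; omega
lemma F_ext {A B : Finset (Fin N)} (h : ∀ i, i ≤ N → F A i = F B i) : A = B := by
  apply has_ext
  intro i hi
  have h1 := h i (by omega)
  have h2 := h (i+1) (by omega)
  rw [F_succ, F_succ, h1] at h2
  rw [← e_eq_one, ← e_eq_one]
  constructor <;> intro <;> omega

/-- reversal inside a finset -/
noncomputable def rev (C : Finset (Fin T)) (x : Fin T) : Fin T :=
  if h : x ∈ C then C.orderIsoOfFin rfl (Fin.rev ((C.orderIsoOfFin rfl).symm ⟨x, h⟩)) else x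

lemma rev_mem (C : Finset (Fin T)) (x : Fin T) (h : x ∈ C) : rev C x ∈ C := by
  rw [rev, dif_pos h]; exact Subtype.coe_prop _
lemma rev_rev (C : Finset (Fin T)) (x : Fin T) : rev C (rev C x) = x := by
  by_cases h : x ∈ C
  · have h2 := rev_mem C x h
    rw [rev, dif_pos h2]
    have : (⟨rev C x, h2⟩ : C) = C.orderIsoOfFin rfl (Fin.rev ((C.orderIsoOfFin rfl).symm ⟨x, h⟩)) := by
      ext; simp [rev, h]
    rw [this]; simp
  · simp [rev, h]
lemma rev_anti (C : Finset (Fin T)) (x y : Fin T) (hx : x ∈ C) (hy : y ∈ C) (h : x ≤ y) :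
    rev C y ≤ rev C x := by
  rw [rev, rev, dif_pos hx, dif_pos hy]
  simp [h]

open Classical in
noncomputable def cls (q t0 : ℕ) (κ : Fin T → ℤ × ℤ) (t : Fin T) : Finset (Fin T) :=
  univ.filter fun s => t0 ≤ s.val ∧ s.val % q = t.val % q ∧ κ s = κ t

noncomputable def rho (q t0 : ℕ) (κ : Fin T → ℤ × ℤ) (t : Fin T) : Fin T := rev (cls q t0 κ t) t

lemma rho_prop (q t0 : ℕ) (κ : Fin T → ℤ × ℤ) (t : Fin T) (h : t0 ≤ t.val) :
    t0 ≤ (rho q t0 κ t).val ∧ (rho q t0 κ t).val % q = t.val % q ∧ κ (rho q t0 κ t) = κ t := by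
  have := rev_mem (cls q t0 κ t) t (by simp [cls, h])
  rw [show rev (cls q t0 κ t) t = rho q t0 κ t from rfl, cls, mem_filter] at this
  exact this.2

lemma cls_rho (q t0 : ℕ) (κ : Fin T → ℤ × ℤ) (t : Fin T) (h : t0 ≤ t.val) :
    cls q t0 κ (rho q t0 κ t) = cls q t0 κ t := by
  obtain ⟨_, h2, h3⟩ := rho_prop q t0 κ t h
  simp only [cls, h2, h3]

lemma rho_rho (q t0 : ℕ) (κ : Fin T → ℤ × ℤ) (t : Fin T) (h : t0 ≤ t.val) :
    rho q t0 κ (rho q t0 κ t) = t := by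
  have := cls_rho q t0 κ t h
  rw [rho, this, rho, rev_rev]

lemma rho_anti (q t0 : ℕ) (κ : Fin T → ℤ × ℤ) (s t : Fin T) (h : t0 ≤ s.val) (hst : s ≤ t)
    (hq : s.val % q = t.val % q) (hk : κ s = κ t) : rho q t0 κ t ≤ rho q t0 κ s := by
  have : cls q t0 κ s = cls q t0 κ t := by simp only [cls, hq, hk]
  rw [rho, rho, this]
  have h' : s.val ≤ t.val := hst
  apply rev_anti
  · simp [cls, h, hq, hk]
  · simp [cls]; omega
  · exact hst

noncomputable def kap (v : ℕ) (D : Fin T → Finset (Fin N)) (t : Fin T) : ℤ × ℤ :=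
  (F (D t) v, F (D t) (v+2))

open Classical in
noncomputable def bk (q t0 v : ℕ) (D : Fin T → Finset (Fin N)) (t : Fin T) : Finset (Fin N) :=
  if t0 ≤ t.val then
    univ.filter fun x => if x.val = v ∨ x.val = v+1
      then has (D (rho q t0 (kap v D) t)) (Equiv.swap v (v+1) x.val) else x ∈ D t
  else D t

lemma bk_lt (q t0 v : ℕ) (D : Fin T → Finset (Fin N)) (t : Fin T) (h : t.val < t0) :
    bk q t0 v D t = D t := by
  rw [bk, if_neg (by omega)]

lemma bk_v (q t0 v : ℕ) (hv : v + 1 < N) (D : Fin T → Finset (Fin N)) (t : Fin T) (h : t0 ≤ t.val) :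
    has (bk q t0 v D t) v ↔ has (D (rho q t0 (kap v D) t)) (v+1) := by
  have := has_val (A := bk q t0 v D t) ⟨v, by omega⟩
  simp only at this
  rw [this, bk, if_pos h]; simp

lemma bk_v1 (q t0 v : ℕ) (hv : v + 1 < N) (D : Fin T → Finset (Fin N)) (t : Fin T) (h : t0 ≤ t.val) :
    has (bk q t0 v D t) (v+1) ↔ has (D (rho q t0 (kap v D) t)) v := by
  have := has_val (A := bk q t0 v D t) ⟨v+1, by omega⟩
  simp only at this
  rw [this, bk, if_pos h]; simp

lemma bk_ne (q t0 v : ℕ) (D : Fin T → Finset (Fin N)) (t : Fin T) (i : ℕ)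
    (h1 : i ≠ v) (h2 : i ≠ v+1) : has (bk q t0 v D t) i ↔ has (D t) i := by
  by_cases h : t0 ≤ t.val
  · by_cases hi : i < N
    · have := has_val (A := bk q t0 v D t) ⟨i, hi⟩
      have h' := has_val (A := D t) ⟨i, hi⟩
      simp only at this h'
      rw [this, h', bk, if_pos h]; simp [h1, h2]
    · constructor <;> rintro ⟨h, _⟩ <;> omega
  · rw [bk, if_neg h]

lemma F_bk_le (q t0 v : ℕ) (D : Fin T → Finset (Fin N)) (t : Fin T) (i : ℕ)
    (h1 : i ≤ v) : F (bk q t0 v D t) i = F (D t) i := by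
  unfold F
  apply sum_congr rfl
  intro j hj
  simp only [mem_range] at hj
  exact e_congr (bk_ne _ _ _ _ _ _ (by omega) (by omega))

lemma F_bk_mid (q t0 v : ℕ) (hv : v + 1 < N) (D : Fin T → Finset (Fin N)) (t : Fin T) (h : t0 ≤ t.val) :
    F (bk q t0 v D t) (v+1) = F (D t) v + F (D t) (v+2) - F (D (rho q t0 (kap v D) t)) (v+1) := by
  obtain ⟨_, _, h3⟩ := rho_prop q t0 (kap v D) t h
  simp only [kap, Prod.mk.injEq] at h3
  rw [F_succ, F_bk_le _ _ _ _ _ _ le_rfl, e_congr (bk_v q t0 v hv D t h), ← h3.2,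
    F_succ _ (v+1)]
  ring

lemma F_bk_ge (q t0 v : ℕ) (hv : v + 1 < N) (D : Fin T → Finset (Fin N)) (t : Fin T) (i : ℕ)
    (h1 : v + 2 ≤ i) : F (bk q t0 v D t) i = F (D t) i := by
  by_cases h : t0 ≤ t.val
  · induction i, h1 using Nat.le_induction with
    | base =>
      rw [F_succ, F_bk_mid q t0 v hv D t h, e_congr (bk_v1 q t0 v hv D t h)]
      obtain ⟨_, _, h3⟩ := rho_prop q t0 (kap v D) t h
      simp only [kap, Prod.mk.injEq] at h3
      rw [F_succ _ v, h3.1]; ring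
    | succ i hi ih =>
      rw [F_succ, F_succ, ih, e_congr (bk_ne q t0 v D t i (by omega) (by omega))]
  · rw [bk, if_neg h]

lemma kap_bk (q t0 v : ℕ) (hv : v + 1 < N) (D : Fin T → Finset (Fin N)) :
    kap v (bk q t0 v D) = kap v D := by
  ext t
  · exact F_bk_le _ _ _ _ _ _ le_rfl
  · exact F_bk_ge _ _ _ hv _ _ _ le_rfl

lemma card_bk (q t0 v : ℕ) (hv : v + 1 < N) (D : Fin T → Finset (Fin N)) (t : Fin T) :
    (bk q t0 v D t).card = (D t).card := by
  have := F_bk_ge q t0 v hv D t N hv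
  rw [F_N, F_N] at this
  exact_mod_cast this

lemma bk_bk (q t0 v : ℕ) (hv : v + 1 < N) (D : Fin T → Finset (Fin N)) :
    bk q t0 v (bk q t0 v D) = D := by
  funext t
  by_cases h : t0 ≤ t.val
  · apply has_ext
    intro i hi
    have hr := (rho_prop q t0 (kap v D) t h).1
    by_cases h1 : i = v
    · subst h1
      rw [bk_v _ _ _ hv _ _ h, kap_bk _ _ _ hv, bk_v1 _ _ _ hv _ _ hr, rho_rho _ _ _ _ h]
    · by_cases h2 : i = v + 1
      · subst h2
        rw [bk_v1 _ _ _ hv _ _ h, kap_bk _ _ _ hv, bk_v _ _ _ hv _ _ hr, rho_rho _ _ _ _ h]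
      · rw [bk_ne _ _ _ _ _ _ h1 h2, bk_ne _ _ _ _ _ _ h1 h2]
  · rw [bk_lt _ _ _ _ _ (by omega), bk_lt _ _ _ _ _ (by omega)]

def Chn (q : ℕ) (D : Fin T → Finset (Fin N)) : Prop :=
  ∀ s t : Fin T, s ≤ t → s.val % q = t.val % q → ∀ i, F (D s) i ≤ F (D t) i

lemma chn_bk (q t0 v : ℕ) (hv : v + 1 < N) (D : Fin T → Finset (Fin N)) (hD : Chn q D)
    (hj : ∀ s t : Fin T, s.val < t0 → t0 ≤ t.val → s.val % q = t.val % q →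
      ∃ r : Fin T, s ≤ r ∧ r ≤ t ∧ r.val % q = s.val % q ∧ (has (D r) v → has (D r) (v+1))) :
    Chn q (bk q t0 v D) := by
  intro s t hst hq i
  have hst' : s.val ≤ t.val := hst
  by_cases hi : i ≤ v
  · rw [F_bk_le _ _ _ _ _ _ hi, F_bk_le _ _ _ _ _ _ hi]; exact hD s t hst hq i
  by_cases hi2 : v + 2 ≤ i
  · rw [F_bk_ge _ _ _ hv _ _ _ hi2, F_bk_ge _ _ _ hv _ _ _ hi2]; exact hD s t hst hq i
  have : i = v + 1 := by omega
  subst this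
  by_cases ht : t.val < t0
  · rw [bk_lt _ _ _ _ _ ht, bk_lt _ _ _ _ _ (by omega)]; exact hD s t hst hq _
  have ht' : t0 ≤ t.val := by omega
  have hb : ∀ t : Fin T, t0 ≤ t.val → F (D t) v ≤ F (bk q t0 v D t) (v+1) ∧
      F (D t) (v+2) - 1 ≤ F (bk q t0 v D t) (v+1) ∧ F (bk q t0 v D t) (v+1) ≤ F (D t) v + 1 ∧
      F (bk q t0 v D t) (v+1) ≤ F (D t) (v+2) := by
    intro t ht
    have e1 := F_bk_le q t0 v D t v le_rfl
    have e2 := F_bk_ge q t0 v hv D t (v+2) le_rfl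
    have e3 := F_succ (bk q t0 v D t) v
    have e4 := F_succ (bk q t0 v D t) (v+1)
    have e5 := e_nonneg (bk q t0 v D t) v
    have e6 := e_nonneg (bk q t0 v D t) (v+1)
    have e7 := e_le_one (bk q t0 v D t) v
    have e8 := e_le_one (bk q t0 v D t) (v+1)
    simp only [add_assoc, Nat.reduceAdd] at e4
    omega
  by_cases hs : s.val < t0
  · obtain ⟨r, h1, h2, h3, h4⟩ := hj s t hs ht' hq
    rw [bk_lt _ _ _ _ _ hs]
    refine (hD s r h1 h3.symm (v+1)).trans ?_
    have b := hb t ht'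
    have c1 := hD r t h2 (by omega) v
    have c2 := hD r t h2 (by omega) (v+2)
    have e3 := F_succ (D r) v
    have e4 := F_succ (D r) (v+1)
    simp only [add_assoc, Nat.reduceAdd] at e4
    by_cases hh : has (D r) v
    · have := e_eq_one.2 (h4 hh)
      omega
    · have := e_eq_zero.2 hh
      omega
  · have hs' : t0 ≤ s.val := by omega
    by_cases hk : kap v D s = kap v D t
    · rw [F_bk_mid _ _ _ hv _ _ hs', F_bk_mid _ _ _ hv _ _ ht']
      have h1 := rho_anti q t0 (kap v D) s t hs' hst hq hk
      have h2 := hD _ _ h1 (by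
        rw [(rho_prop q t0 (kap v D) s hs').2.1, (rho_prop q t0 (kap v D) t ht').2.1, hq]) (v+1)
      simp only [kap, Prod.mk.injEq] at hk
      omega
    · simp only [kap, Prod.mk.injEq] at hk
      have b1 := hb s hs'
      have b2 := hb t ht'
      have c1 := hD s t hst hq v
      have c2 := hD s t hst hq (v+2)
      omega

open Classical in
/-- number of letters `i` in the first `t` columns -/
noncomputable def W (D : Fin T → Finset (Fin N)) (t i : ℕ) : ℕ :=
  (univ.filter fun s : Fin T => s.val < t ∧ has (D s) i).card

open Classical in
lemma W_bk_pre (q t0 v : ℕ) (D : Fin T → Finset (Fin N)) (t i : ℕ) (h : t ≤ t0) :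
    W (bk q t0 v D) t i = W D t i := by
  unfold W
  congr 1
  apply filter_congr
  intro s _
  apply and_congr_right
  intro hs
  rw [bk_lt _ _ _ _ _ (by omega)]

open Classical in
noncomputable def V (D : Fin T → Finset (Fin N)) (t i : ℕ) : ℕ :=
  (univ.filter fun s : Fin T => t ≤ s.val ∧ has (D s) i).card

lemma W_add_V (D : Fin T → Finset (Fin N)) (t i : ℕ) : W D T i = W D t i + V D t i := by
  classical
  unfold W V
  rw [← Finset.card_union_of_disjoint]
  · congr 1
    ext s
    simp only [mem_filter, mem_univ, true_and, mem_union]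
    have := s.2
    constructor
    · rintro ⟨_, h⟩
      by_cases h' : s.val < t
      · exact Or.inl ⟨h', h⟩
      · exact Or.inr ⟨by omega, h⟩
    · rintro (h | h)
      · exact ⟨this, h.2⟩
      · exact ⟨this, h.2⟩
  · rw [Finset.disjoint_filter]
    intro s _ h1 h2
    omega

lemma V_bk_ne (q t0 v : ℕ) (D : Fin T → Finset (Fin N)) (i : ℕ) (h1 : i ≠ v) (h2 : i ≠ v+1) :
    V (bk q t0 v D) t0 i = V D t0 i := by
  classical
  unfold V
  congr 1
  apply filter_congr
  intro s _
  rw [bk_ne _ _ _ _ _ _ h1 h2]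

lemma V_bk_v (q t0 v : ℕ) (hv : v + 1 < N) (D : Fin T → Finset (Fin N)) :
    V (bk q t0 v D) t0 v = V D t0 (v+1) := by
  classical
  unfold V
  apply Finset.card_bij' (fun s _ => rho q t0 (kap v D) s) (fun s _ => rho q t0 (kap v D) s)
  · intro s hs
    simp only [mem_filter, mem_univ, true_and] at hs ⊢
    exact ⟨(rho_prop _ _ _ _ hs.1).1, (bk_v _ _ _ hv _ _ hs.1).1 hs.2⟩
  · intro s hs
    simp only [mem_filter, mem_univ, true_and] at hs ⊢
    refine ⟨(rho_prop _ _ _ _ hs.1).1, (bk_v _ _ _ hv _ _ (rho_prop _ _ _ _ hs.1).1).2 ?_⟩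
    rw [rho_rho _ _ _ _ hs.1]; exact hs.2
  · intro s hs
    simp only [mem_filter, mem_univ, true_and] at hs
    exact rho_rho _ _ _ _ hs.1
  · intro s hs
    simp only [mem_filter, mem_univ, true_and] at hs
    exact rho_rho _ _ _ _ hs.1

lemma V_bk_v1 (q t0 v : ℕ) (hv : v + 1 < N) (D : Fin T → Finset (Fin N)) :
    V (bk q t0 v D) t0 (v+1) = V D t0 v := by
  have := V_bk_v q t0 v hv (bk q t0 v D)
  rw [bk_bk _ _ _ hv] at this
  exact this.symm

end LLT

section
namespace LLT
variable {N T : ℕ}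

lemma W_bk (q t0 v : ℕ) (hv : v + 1 < N) (D : Fin T → Finset (Fin N)) (i : ℕ) :
    W (bk q t0 v D) T i = W D t0 i + V D t0 (Equiv.swap v (v+1) i) := by
  rw [W_add_V _ t0, W_bk_pre _ _ _ _ _ _ le_rfl]
  congr 1
  by_cases h1 : i = v
  · subst h1; simp [V_bk_v _ _ _ hv]
  · by_cases h2 : i = v + 1
    · subst h2; simp [V_bk_v1 _ _ _ hv]
    · rw [Equiv.swap_apply_of_ne_of_ne h1 h2, V_bk_ne _ _ _ _ _ h1 h2]

lemma W_zero (D : Fin T → Finset (Fin N)) (i : ℕ) : W D 0 i = 0 := by simp [W]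

open Classical in
lemma W_succ (D : Fin T → Finset (Fin N)) (t : ℕ) (ht : t < T) (i : ℕ) :
    W D (t+1) i = W D t i + if has (D ⟨t, ht⟩) i then 1 else 0 := by
  unfold W
  have : (univ.filter fun s : Fin T => s.val < t+1 ∧ has (D s) i) =
      (univ.filter fun s : Fin T => s.val < t ∧ has (D s) i) ∪
      (if has (D ⟨t, ht⟩) i then {⟨t, ht⟩} else ∅) := by
    ext s
    simp only [mem_filter, mem_univ, true_and, mem_union]
    by_cases hs : s = ⟨t, ht⟩
    · subst hs
      split_ifs <;> simp_all
    · have : s.val ≠ t := fun h => hs (Fin.ext h)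
      have e : (s.val < t + 1) ↔ s.val < t := by omega
      split_ifs <;> simp [e, hs]
  rw [this, card_union_of_disjoint]
  · split_ifs <;> simp
  · split_ifs <;> simp

noncomputable def mon (D : Fin T → Finset (Fin N)) : MvPolynomial (Fin N) ℤ :=
  ∏ v : Fin N, MvPolynomial.X v ^ W D T v

open Classical in
noncomputable def base (N q : ℕ) (α : Fin T → ℕ) : Finset (Fin T → Finset (Fin N)) :=
  univ.filter fun D => Chn q D ∧ ∀ s, (D s).card = α s

noncomputable def tq (N q : ℕ) (α : Fin T → ℕ) : MvPolynomial (Fin N) ℤ :=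
  ∑ D ∈ base N q α, mon D

lemma mem_base {q : ℕ} {α : Fin T → ℕ} {D : Fin T → Finset (Fin N)} :
    D ∈ base N q α ↔ Chn q D ∧ ∀ s, (D s).card = α s := by simp [base]

lemma bk_mem_base (q t0 v : ℕ) (hv : v + 1 < N) (α : Fin T → ℕ) (D : Fin T → Finset (Fin N))
    (hD : D ∈ base N q α)
    (hj : ∀ s t : Fin T, s.val < t0 → t0 ≤ t.val → s.val % q = t.val % q →
      ∃ r : Fin T, s ≤ r ∧ r ≤ t ∧ r.val % q = s.val % q ∧ (has (D r) v → has (D r) (v+1))) :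
    bk q t0 v D ∈ base N q α := by
  rw [mem_base] at hD ⊢
  exact ⟨chn_bk q t0 v hv D hD.1 hj, fun s => by rw [card_bk q t0 v hv, hD.2]⟩

lemma swap_val {n : ℕ} (i : Fin n) (x : Fin (n+1)) :
    ((Equiv.swap i.castSucc i.succ x : Fin (n+1)) : ℕ) = Equiv.swap (i : ℕ) (i+1) x := by
  by_cases h1 : x = i.castSucc
  · subst h1; simp
  · by_cases h2 : x = i.succ
    · subst h2; simp
    · rw [Equiv.swap_apply_of_ne_of_ne h1 h2, Equiv.swap_apply_of_ne_of_ne]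
      · intro h; exact h1 (Fin.ext h)
      · intro h; exact h2 (Fin.ext h)

lemma tq_swap {n : ℕ} (q : ℕ) (α : Fin T → ℕ) (i : Fin n) :
    MvPolynomial.rename (Equiv.swap i.castSucc i.succ) (tq (n+1) q α) = tq (n+1) q α := by
  unfold tq
  rw [map_sum]
  have hi : i.val + 1 < n + 1 := by omega
  have key : ∀ D ∈ base (n+1) q α, bk q 0 i D ∈ base (n+1) q α := fun D hD =>
    bk_mem_base q 0 i hi α D hD (by intro s t h; omega)
  apply sum_bij' (fun D _ => bk q 0 i D) (fun D _ => bk q 0 i D) key key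
    (fun D _ => bk_bk _ _ _ hi D) (fun D _ => bk_bk _ _ _ hi D)
  intro D _
  unfold mon
  rw [map_prod]
  simp only [map_pow, MvPolynomial.rename_X]
  apply Fintype.prod_equiv (Equiv.swap i.castSucc i.succ)
  intro x
  rw [W_bk _ _ _ hi, W_zero, zero_add, swap_val, Equiv.swap_apply_self, W_add_V D 0, W_zero, zero_add]

lemma tq_symm (q : ℕ) (α : Fin T → ℕ) (σ : Equiv.Perm (Fin N)) :
    MvPolynomial.rename σ (tq N q α) = tq N q α := by
  cases N with
  | zero => rw [Subsingleton.elim σ 1]; simp [Equiv.Perm.coe_one]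
  | succ n =>
    have h : σ ∈ Submonoid.closure (Set.range fun i : Fin n ↦ Equiv.swap i.castSucc i.succ) := by
      rw [Equiv.Perm.mclosure_swap_castSucc_succ]; trivial
    induction h using Submonoid.closure_induction with
    | mem x hx => obtain ⟨i, rfl⟩ := hx; exact tq_swap q α i
    | one => simp [Equiv.Perm.coe_one]
    | mul x y _ _ hx hy =>
      rw [Equiv.Perm.coe_mul, ← MvPolynomial.rename_rename, hy, hx]

noncomputable def alt (α : Fin N → ℕ) : MvPolynomial (Fin N) ℤ :=
  Matrix.det (Matrix.of fun i j : Fin N => (MvPolynomial.X i : MvPolynomial (Fin N) ℤ) ^ α j)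

lemma alt_swap (α : Fin N → ℕ) (a b : Fin N) (h : a ≠ b) :
    alt (fun i => α (Equiv.swap a b i)) = - alt α := by
  unfold alt
  have := Matrix.det_permute' (Equiv.swap a b)
    (Matrix.of fun i j : Fin N => (MvPolynomial.X i : MvPolynomial (Fin N) ℤ) ^ α j)
  rw [Equiv.Perm.sign_swap h] at this
  simp only [Units.val_neg, Units.val_one, Int.cast_neg, Int.cast_one, neg_mul, one_mul] at this
  rw [← this]; rfl

def del (N : ℕ) (i : Fin N) : ℕ := N - 1 - i

lemma alt_mul_tq (q : ℕ) (α : Fin T → ℕ) (γ : Fin N → ℕ) :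
    alt γ * tq N q α = ∑ D ∈ base N q α, alt (fun i => γ i + W D T i) := by
  unfold alt
  simp only [Matrix.det_apply, Matrix.of_apply, sum_mul]
  rw [sum_comm]
  apply sum_congr rfl
  intro σ _
  rw [smul_mul_assoc, ← tq_symm q α σ, ← smul_sum]
  congr 1
  unfold tq mon
  rw [map_sum, mul_sum]
  apply sum_congr rfl
  intro D _
  simp only [map_prod, map_pow, MvPolynomial.rename_X, pow_add, prod_mul_distrib]

def Yst (t v : ℕ) (D : Fin T → Finset (Fin N)) : Prop :=
  (∀ s ≤ t, ∀ i, i + 1 < N → W D s (i+1) ≤ W D s i) ∧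
  ∀ i < v, i + 1 < N → W D (t+1) (i+1) ≤ W D (t+1) i

def Yam (D : Fin T → Finset (Fin N)) : Prop :=
  ∀ s ≤ T, ∀ i, i + 1 < N → W D s (i+1) ≤ W D s i

open Classical in
lemma stage_zero (q t v : ℕ) (hq : 1 ≤ q) (hq2 : q ≤ 2) (hv : v + 1 < N) (ht : t < T) (α : Fin T → ℕ) :
    ∑ D ∈ (base N q α).filter (fun D => Yst t v D ∧ W D (t+1) v < W D (t+1) (v+1)),
      alt (fun i => del N i + W D T i) = 0 := by
  have hneg : ∀ D ∈ (base N q α).filter (fun D => Yst t v D ∧ W D (t+1) v < W D (t+1) (v+1)),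
      alt (fun i => del N i + W (bk q (t+1) v D) T i) = - alt (fun i => del N i + W D T i) := by
    intro D hD
    simp only [mem_filter] at hD
    obtain ⟨hb, hY, hlt⟩ := hD
    have h1 := W_succ D t ht v
    have h2 := W_succ D t ht (v+1)
    have h3 := hY.1 t le_rfl v hv
    have h4 : W D (t+1) (v+1) = W D (t+1) v + 1 := by
      split_ifs at h1 h2 <;> omega
    rw [← alt_swap _ (⟨v, by omega⟩ : Fin N) ⟨v+1, hv⟩ (by simp)]
    congr 1
    funext i
    rw [W_bk _ _ _ hv]
    by_cases hi1 : i = ⟨v, by omega⟩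
    · subst hi1
      simp only [Equiv.swap_apply_left, del]
      rw [W_add_V D (t+1) (v+1)]
      omega
    · by_cases hi2 : i = ⟨v+1, hv⟩
      · subst hi2
        simp only [Equiv.swap_apply_right, del]
        rw [W_add_V D (t+1) v]
        omega
      · rw [Equiv.swap_apply_of_ne_of_ne hi1 hi2, Equiv.swap_apply_of_ne_of_ne, W_add_V D (t+1) i]
        · intro h; exact hi1 (Fin.ext h)
        · intro h; exact hi2 (Fin.ext h)
  apply Finset.sum_involution (fun D _ => bk q (t+1) v D)
  · intro D hD
    rw [hneg D hD]; ring
  · intro D hD h0 heq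
    have := hneg D hD
    rw [heq] at this
    exact h0 (by simpa using self_eq_neg.1 this)
  swap
  · intro D hD
    exact bk_bk _ _ _ hv D
  · intro D hD
    simp only [mem_filter] at hD ⊢
    obtain ⟨hb, hY, hlt⟩ := hD
    have pre : ∀ s ≤ t+1, ∀ i, W (bk q (t+1) v D) s i = W D s i :=
      fun s hs i => W_bk_pre _ _ _ _ _ _ hs
    refine ⟨?_, ⟨?_, ?_⟩, ?_⟩
    · apply bk_mem_base _ _ _ hv _ _ hb
      intro s t' hs ht' hqq
      have h1 := W_succ D t ht v
      have h2 := W_succ D t ht (v+1)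
      have h3 := hY.1 t le_rfl v hv
      by_cases hst : s.val % q = t % q
      · refine ⟨⟨t, ht⟩, ?_, ?_, hst.symm, ?_⟩
        · rw [Fin.le_def]; simp only; omega
        · rw [Fin.le_def]; simp only; omega
        · intro hh
          by_contra hh2
          rw [if_pos hh] at h1
          rw [if_neg hh2] at h2
          omega
      · have hq2' : q = 2 := by
          rcases (show q = 1 ∨ q = 2 by omega) with h | h
          · subst h; omega
          · exact h
        subst hq2'
        have hs' : s.val ≤ t - 1 := by
          rcases Nat.lt_or_ge s.val t with h | h
          · omega
          · have : s.val = t := by omega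
            rw [this] at hst; exact absurd rfl hst
        have ht1 : 1 ≤ t := by
          by_contra h
          apply hst
          omega
        obtain ⟨u, rfl⟩ : ∃ u, t = u + 1 := ⟨t-1, by omega⟩
        refine ⟨⟨u, by omega⟩, ?_, ?_, ?_, ?_⟩
        · rw [Fin.le_def]; simp only; omega
        · rw [Fin.le_def]; simp only; omega
        · simp only; omega
        · intro hh
          by_contra hh2
          have g1 := W_succ D u (by omega) v
          have g2 := W_succ D u (by omega) (v+1)
          have g3 := hY.1 u (by omega) v hv
          rw [if_pos hh] at g1
          rw [if_neg hh2] at g2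
          split_ifs at h1 h2 <;> omega
    · intro s hs i hi
      rw [pre s (by omega), pre s (by omega)]; exact hY.1 s hs i hi
    · intro i hi hi'
      rw [pre _ le_rfl, pre _ le_rfl]; exact hY.2 i hi hi'
    · rw [pre _ le_rfl, pre _ le_rfl]; exact hlt

open Classical in
noncomputable def ysum (q t v : ℕ) (α : Fin T → ℕ) : MvPolynomial (Fin N) ℤ :=
  ∑ D ∈ (base N q α).filter (fun D => Yst t v D), alt (fun i => del N i + W D T i)

lemma ysum_succ (q t v : ℕ) (hq : 1 ≤ q) (hq2 : q ≤ 2) (ht : t < T) (α : Fin T → ℕ) :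
    ysum (N := N) q t v α = ysum q t (v+1) α := by
  classical
  unfold ysum
  by_cases hv : v + 1 < N
  · rw [← sum_filter_add_sum_filter_not _ (fun D => W D (t+1) v < W D (t+1) (v+1)), filter_filter,
      filter_filter, stage_zero q t v hq hq2 hv ht, zero_add]
    apply sum_congr _ (fun _ _ => rfl)
    apply filter_congr
    intro D _
    constructor
    · rintro ⟨⟨h1, h2⟩, h3⟩
      refine ⟨h1, fun i hi hi' => ?_⟩
      rcases Nat.lt_or_ge i v with h | h
      · exact h2 i h hi'
      · have : i = v := by omega
        subst this; omega
    · rintro ⟨h1, h2⟩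
      exact ⟨⟨h1, fun i hi => h2 i (by omega)⟩, by have := h2 v (by omega) hv; omega⟩
  · apply sum_congr _ (fun _ _ => rfl)
    apply filter_congr
    intro D _
    constructor
    · rintro ⟨h1, h2⟩
      exact ⟨h1, fun i hi hi' => h2 i (by omega) hi'⟩
    · rintro ⟨h1, h2⟩
      exact ⟨h1, fun i hi hi' => h2 i (by omega) hi'⟩

lemma ysum_zero (q t v : ℕ) (hq : 1 ≤ q) (hq2 : q ≤ 2) (ht : t < T) (α : Fin T → ℕ) :
    ysum (N := N) q t 0 α = ysum q t v α := by
  induction v with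
  | zero => rfl
  | succ v ih => rw [ih, ysum_succ _ _ _ hq hq2 ht]

lemma ysum_next (q t : ℕ) (α : Fin T → ℕ) :
    ysum (N := N) q t N α = ysum q (t+1) 0 α := by
  classical
  unfold ysum
  apply sum_congr _ (fun _ _ => rfl)
  apply filter_congr
  intro D _
  constructor
  · rintro ⟨h1, h2⟩
    refine ⟨fun s hs i hi => ?_, fun i hi => by omega⟩
    rcases Nat.lt_or_ge t s with h | h
    · have : s = t + 1 := by omega
      subst this; exact h2 i (by omega) hi
    · exact h1 s h i hi
  · rintro ⟨h1, h2⟩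
    exact ⟨fun s hs => h1 s (by omega), fun i hi => h1 (t+1) le_rfl i⟩

lemma ysum_all (q t : ℕ) (hq : 1 ≤ q) (hq2 : q ≤ 2) (ht : t ≤ T) (α : Fin T → ℕ) :
    ysum (N := N) q 0 0 α = ysum q t 0 α := by
  induction t with
  | zero => rfl
  | succ t ih => rw [ih (by omega), ysum_zero q t N hq hq2 (by omega), ysum_next]

open Classical in
/-- Littlewood–Richardson style expansion -/
theorem alt_mul_tq_yam (q : ℕ) (hq : 1 ≤ q) (hq2 : q ≤ 2) (α : Fin T → ℕ) :
    alt (del N) * tq N q α =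
      ∑ D ∈ (base N q α).filter Yam, alt (fun i => del N i + W D T i) := by
  rw [alt_mul_tq]
  have h1 : ysum (N := N) q 0 0 α = ∑ D ∈ base N q α, alt (fun i => del N i + W D T i) := by
    unfold ysum
    apply sum_congr _ (fun _ _ => rfl)
    apply filter_true_of_mem
    intro D _
    refine ⟨fun s hs i hi => ?_, fun i hi => by omega⟩
    have : s = 0 := by omega
    subst this; simp [W_zero]
  rw [← h1, ysum_all q T hq hq2 le_rfl]
  unfold ysum
  apply sum_congr _ (fun _ _ => rfl)
  apply filter_congr
  intro D _
  constructor
  · exact fun h => h.1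
  · exact fun h => ⟨h, fun i hi => by omega⟩

end LLT

end

section
namespace LLT
variable {N T : ℕ}

noncomputable def HH (N : ℕ) : PowerSeries (MvPolynomial (Fin N) ℤ) :=
  PowerSeries.mk fun m => MvPolynomial.hsymm (Fin N) ℤ m

noncomputable def geo (N : ℕ) (i : Fin N) : PowerSeries (MvPolynomial (Fin N) ℤ) :=
  PowerSeries.mk fun m => (MvPolynomial.X i) ^ m

noncomputable def lin (N : ℕ) (i : Fin N) : PowerSeries (MvPolynomial (Fin N) ℤ) :=
  1 - PowerSeries.C (MvPolynomial.X i) * PowerSeries.X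

lemma lin_mul_geo (i : Fin N) : lin N i * geo N i = 1 := by
  ext m
  rw [lin, sub_mul, one_mul, mul_assoc, map_sub, PowerSeries.coeff_C_mul]
  cases m with
  | zero => simp [geo]
  | succ m =>
    rw [mul_comm PowerSeries.X, PowerSeries.coeff_succ_mul_X]
    simp [geo, PowerSeries.coeff_one, pow_succ']

lemma HH_eq : HH N = ∏ i, geo N i := by
  classical
  ext1 m
  rw [PowerSeries.coeff_prod, HH, PowerSeries.coeff_mk, MvPolynomial.hsymm]
  refine Finset.sum_bij (fun s _ => (Sym.equivNatSum (Fin N) m s : Fin N →₀ ℕ)) ?_ ?_ ?_ ?_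
  · intro s _
    have := (Sym.equivNatSum (Fin N) m s).2
    rw [Finsupp.sum_fintype _ _ (by simp)] at this
    exact mem_finsuppAntidiag.2 ⟨this, subset_univ _⟩
  · intro s _ t _ h
    exact (Sym.equivNatSum (Fin N) m).injective (Subtype.ext h)
  · intro P hP
    refine ⟨(Sym.equivNatSum (Fin N) m).symm ⟨P, ?_⟩, mem_univ _, by simp⟩
    rw [Finsupp.sum_fintype _ _ (by simp)]
    simpa using hP
  · intro s _
    simp only [geo, PowerSeries.coeff_mk, Sym.coe_equivNatSum_apply_apply]
    rw [Finset.prod_multiset_map_count]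
    apply Finset.prod_subset (subset_univ _)
    intro x _ hx
    simp only [Multiset.mem_toFinset] at hx
    rw [Multiset.count_eq_zero_of_notMem hx, pow_zero]

lemma coeff_prod_lin (s : Finset (Fin N)) (m : ℕ) (h : s.card < m) :
    PowerSeries.coeff m (∏ i ∈ s, lin N i) = 0 := by
  classical
  induction s using Finset.induction_on generalizing m with
  | empty => simp at h; simp [PowerSeries.coeff_one]; omega
  | insert a s ha ih =>
    rw [card_insert_of_notMem ha] at h
    rw [prod_insert ha, lin, sub_mul, one_mul, mul_assoc, map_sub, PowerSeries.coeff_C_mul]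
    obtain ⟨u, rfl⟩ : ∃ u, m = u + 1 := ⟨m-1, by omega⟩
    rw [mul_comm PowerSeries.X, PowerSeries.coeff_succ_mul_X, ih _ (by omega), ih _ (by omega)]
    simp

lemma homog_nat (m : ℕ) : homog N (m : ℤ) = MvPolynomial.hsymm (Fin N) ℤ m := by
  simp [homog]
lemma homog_neg (m : ℤ) (h : m < 0) : homog N m = 0 := by
  rw [homog, if_neg (by omega)]
lemma homog_zero : homog N 0 = 1 := by
  simp [homog]

lemma coeff_mul_HH (G : PowerSeries (MvPolynomial (Fin N) ℤ)) (d m : ℕ)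
    (hG : ∀ l, d ≤ l → PowerSeries.coeff l G = 0) :
    PowerSeries.coeff m (G * HH N) =
      ∑ l ∈ range d, PowerSeries.coeff l G * homog N ((m : ℤ) - l) := by
  rw [PowerSeries.coeff_mul, Finset.Nat.sum_antidiagonal_eq_sum_range_succ_mk]
  have h1 : ∑ l ∈ range d, PowerSeries.coeff l G * homog N ((m : ℤ) - l) =
      ∑ l ∈ range (m + 1 + d), PowerSeries.coeff l G * homog N ((m : ℤ) - l) := by
    apply sum_subset
    · intro x; simp only [mem_range]; omega
    · intro x _ hx
      rw [hG x (by simpa using hx), zero_mul]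
  rw [h1]
  have h2 : ∑ l ∈ range (m+1), PowerSeries.coeff l G * homog N ((m : ℤ) - l) =
      ∑ l ∈ range (m + 1 + d), PowerSeries.coeff l G * homog N ((m : ℤ) - l) := by
    apply sum_subset
    · intro x; simp only [mem_range]; omega
    · intro x _ hx
      simp only [mem_range] at hx
      rw [homog_neg _ (by omega), mul_zero]
  rw [← h2]
  apply sum_congr rfl
  intro l hl
  simp only [mem_range] at hl
  have : (m : ℤ) - l = ((m - l : ℕ) : ℤ) := by omega
  rw [this, homog_nat, HH, PowerSeries.coeff_mk]

lemma prod_lin_HH : (∏ i, lin N i) * HH N = 1 := by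
  rw [HH_eq, ← prod_mul_distrib]
  simp [lin_mul_geo]

lemma prod_lin_erase_HH (j : Fin N) : (∏ i ∈ univ.erase j, lin N i) * HH N = geo N j := by
  rw [HH_eq, ← mul_prod_erase univ (geo N) (mem_univ j), mul_left_comm, ← prod_mul_distrib]
  simp [lin_mul_geo]

lemma X_pow (j : Fin N) (m : ℕ) : (MvPolynomial.X j : MvPolynomial (Fin N) ℤ) ^ m =
    ∑ l : Fin N, homog N ((m : ℤ) - (N - 1 : ℤ) + l) *
      PowerSeries.coeff (N - 1 - l) (∏ i ∈ univ.erase j, lin N i) := by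
  have h := coeff_mul_HH (∏ i ∈ univ.erase j, lin N i) N m (by
    intro l hl
    apply coeff_prod_lin
    rw [card_erase_of_mem (mem_univ _), card_univ, Fintype.card_fin]
    have := j.2
    omega)
  rw [prod_lin_erase_HH, geo, PowerSeries.coeff_mk] at h
  rw [h, ← Finset.sum_range_reflect, Finset.sum_range]
  apply sum_congr rfl
  intro l _
  rw [mul_comm]
  congr 2
  have := l.2
  omega

noncomputable def hmat (N k : ℕ) (lam : ℕ → ℕ) : Matrix (Fin k) (Fin k) (MvPolynomial (Fin N) ℤ) :=
  Matrix.of fun i j : Fin k => homog N ((lam i : ℤ) - (0 : ℕ) - (i : ℤ) + (j : ℤ))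

lemma skew_eq (k : ℕ) (lam : ℕ → ℕ) : skewSchur N k lam (fun _ => 0) = (hmat N k lam).det := rfl

lemma alt_eq (lam : ℕ → ℕ) : alt (fun i : Fin N => del N i + lam i) =
    skewSchur N N lam (fun _ => 0) *
      (Matrix.of fun l j : Fin N => PowerSeries.coeff (N - 1 - l) (∏ i ∈ univ.erase j, lin N i)).det := by
  rw [skew_eq, ← Matrix.det_mul, alt, ← Matrix.det_transpose]
  congr 1
  ext1 r j
  rw [Matrix.transpose_apply, Matrix.of_apply, X_pow, Matrix.mul_apply]
  apply sum_congr rfl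
  intro l _
  rw [hmat, Matrix.of_apply, Matrix.of_apply]
  congr 2
  have := r.2
  simp only [del]
  omega

lemma skew_zero (k : ℕ) : skewSchur N k (fun _ => 0) (fun _ => 0) = 1 := by
  rw [skew_eq, Matrix.det_of_isUpperTriangular]
  · apply prod_eq_one
    intro i _
    simp [hmat, homog_zero]
  · intro i j hij
    rw [hmat, Matrix.of_apply]
    apply homog_neg
    have : j.val < i.val := hij
    push_cast; omega

theorem jacobi_trudi (lam : ℕ → ℕ) : alt (fun i : Fin N => del N i + lam i) =
    alt (del N) * skewSchur N N lam (fun _ => 0) := by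
  have h := alt_eq (N := N) (fun _ => 0)
  rw [skew_zero, one_mul] at h
  simp only [add_zero] at h
  rw [alt_eq, h, mul_comm]

lemma alt_del_ne : alt (del N) ≠ 0 := by
  have h : alt (del N) = (Matrix.vandermonde (fun i : Fin N => (MvPolynomial.X i : MvPolynomial (Fin N) ℤ))).det *
     ((Equiv.Perm.sign (Fin.revPerm : Equiv.Perm (Fin N)) : ℤ) : MvPolynomial (Fin N) ℤ) := by
    rw [mul_comm, ← Matrix.det_permute', alt]
    congr 1
    ext1 i j
    simp [Matrix.vandermonde, del, Fin.val_rev]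
    congr 1
    omega
  rw [h]
  apply mul_ne_zero
  · rw [Matrix.det_vandermonde_ne_zero_iff]
    exact MvPolynomial.X_injective
  · rcases Int.units_eq_one_or (Equiv.Perm.sign (Fin.revPerm : Equiv.Perm (Fin N))) with h | h <;> simp [h]

lemma skew_stable (k : ℕ) (mu : ℕ → ℕ) (h : mu k = 0) :
    skewSchur N (k+1) mu (fun _ => 0) = skewSchur N k mu (fun _ => 0) := by
  rw [skew_eq, skew_eq, Matrix.det_succ_row _ (Fin.last k), Fin.sum_univ_castSucc]
  rw [sum_eq_zero, zero_add]
  · have h1 : hmat N (k+1) mu (Fin.last k) (Fin.last k) = 1 := by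
      simp [hmat, h, homog_zero]
    rw [h1, ← two_mul]
    simp only [pow_mul, Fin.val_last]
    simp only [Fin.succAbove_last]
    simp
    rfl
  · intro j _
    have : hmat N (k+1) mu (Fin.last k) j.castSucc = 0 := by
      rw [hmat, Matrix.of_apply]
      apply homog_neg
      have := j.2
      simp [h]
    rw [this]; simp

lemma skew_stable_le (k l : ℕ) (hkl : k ≤ l) (mu : ℕ → ℕ) (h : ∀ j, k ≤ j → mu j = 0) :
    skewSchur N l mu (fun _ => 0) = skewSchur N k mu (fun _ => 0) := by
  induction l, hkl using Nat.le_induction with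
  | base => rfl
  | succ l hl ih => rw [skew_stable l mu (h l hl), ih]

lemma skew_vanish (k : ℕ) (hk : N ≤ k) (mu : ℕ → ℕ) (hm : Antitone mu) (h : 1 ≤ mu k) :
    skewSchur N (k+1) mu (fun _ => 0) = 0 := by
  rw [skew_eq, ← Matrix.exists_mulVec_eq_zero_iff]
  refine ⟨fun j => PowerSeries.coeff (k - j) (∏ i, lin N i), ?_, ?_⟩
  · intro h0
    have := congrFun h0 (Fin.last k)
    simp only [Fin.val_last, Nat.sub_self, Pi.zero_apply, PowerSeries.coeff_zero_eq_constantCoeff,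
      map_prod] at this
    simp [lin] at this
  · funext i
    have hi := i.2
    have h1 := hm (show i.val ≤ k by omega)
    have h2 := coeff_mul_HH (∏ i, lin N i) (k+1) (mu i + k - i) (by
      intro l hl
      apply coeff_prod_lin
      rw [card_univ, Fintype.card_fin]; omega)
    rw [prod_lin_HH, PowerSeries.coeff_one, if_neg (by omega), ← Finset.sum_range_reflect,
      Finset.sum_range] at h2
    simp only [Matrix.mulVec, dotProduct, Pi.zero_apply]
    rw [h2]
    apply sum_congr rfl
    intro j _
    rw [mul_comm, hmat, Matrix.of_apply]
    have := j.2
    congr 2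
    push_cast
    omega

end LLT

end

section
namespace LLT
variable {N T : ℕ}

/-! ### The cone of Schur nonnegative polynomials -/

def SS (N : ℕ) : Set (MvPolynomial (Fin N) ℤ) :=
  {f | ∃ (k : ℕ) (lam : ℕ → ℕ), Antitone lam ∧ (∀ j, k ≤ j → lam j = 0) ∧
    f = skewSchur N k lam (fun _ => 0)}

noncomputable def SP (N : ℕ) : AddSubmonoid (MvPolynomial (Fin N) ℤ) := AddSubmonoid.closure (SS N)

lemma isSchurNonneg_of_mem {f : MvPolynomial (Fin N) ℤ} (hf : f ∈ SP N) : IsSchurNonneg N f := by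
  unfold SP at hf
  induction hf using AddSubmonoid.closure_induction with
  | mem f hf =>
    obtain ⟨k, lam, h1, h2, rfl⟩ := hf
    exact ⟨1, fun _ => 1, fun _ => k, fun _ => lam, fun _ => h1, fun _ => h2, by simp⟩
  | zero => exact ⟨0, Fin.elim0, Fin.elim0, fun i => i.elim0, fun i => i.elim0, fun i => i.elim0, by simp⟩
  | add f g _ _ hf hg =>
    obtain ⟨m, c, k, lam, h1, h2, h3⟩ := hf
    obtain ⟨m', c', k', lam', h1', h2', h3'⟩ := hg
    refine ⟨m + m', Fin.append c c', Fin.append k k', Fin.append lam lam', ?_, ?_, ?_⟩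
    · intro i
      refine Fin.addCases (fun i => ?_) (fun i => ?_) i
      · simpa using h1 i
      · simpa using h1' i
    · intro i
      refine Fin.addCases (fun i => ?_) (fun i => ?_) i
      · simpa using h2 i
      · simpa using h2' i
    · rw [Fin.sum_univ_add, h3, h3']; simp

lemma W_beyond (D : Fin T → Finset (Fin N)) (t i : ℕ) (h : N ≤ i) : W D t i = 0 := by
  classical
  unfold W
  rw [card_eq_zero, filter_eq_empty_iff]
  rintro s _ ⟨_, h', _⟩
  omega

lemma W_anti {D : Fin T → Finset (Fin N)} (h : Yam D) : Antitone (fun i => W D T i) := by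
  apply antitone_nat_of_succ_le
  intro i
  by_cases hi : i + 1 < N
  · exact h T le_rfl i hi
  · rw [W_beyond _ _ _ (by omega)]; omega

open Classical in
theorem tq_eq_sum (q : ℕ) (hq : 1 ≤ q) (hq2 : q ≤ 2) (α : Fin T → ℕ) :
    tq N q α = ∑ D ∈ (base N q α).filter Yam, skewSchur N N (fun i => W D T i) (fun _ => 0) := by
  apply mul_left_cancel₀ (alt_del_ne (N := N))
  rw [alt_mul_tq_yam q hq hq2, mul_sum]
  apply sum_congr rfl
  intro D _
  rw [← jacobi_trudi]

lemma schur_W_mem {D : Fin T → Finset (Fin N)} (h : Yam D) :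
    skewSchur N N (fun i => W D T i) (fun _ => 0) ∈ SP N :=
  AddSubmonoid.subset_closure ⟨N, _, W_anti h, fun _ hj => W_beyond _ _ _ hj, rfl⟩

lemma tq_mem (q : ℕ) (hq : 1 ≤ q) (hq2 : q ≤ 2) (α : Fin T → ℕ) : tq N q α ∈ SP N := by
  classical
  rw [tq_eq_sum q hq hq2]
  apply AddSubmonoid.sum_mem
  intro D hD
  exact schur_W_mem (mem_filter.1 hD).2

/-! ### Single chains -/

lemma lower_of_yam {D : Fin T → Finset (Fin N)} (hc : Chn 1 D) (hY : Yam D) (t : ℕ) (ht : t < T) :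
    ∀ i, i + 1 < N → has (D ⟨t, ht⟩) (i+1) → has (D ⟨t, ht⟩) i := by
  classical
  induction t using Nat.strong_induction_on with
  | _ t ih =>
    intro i hi h1
    by_contra h2
    have g1 := W_succ D t ht i
    have g2 := W_succ D t ht (i+1)
    rw [if_neg h2] at g1
    rw [if_pos h1] at g2
    have g3 := hY (t+1) ht i hi
    have g4 : 0 < W D t i := by omega
    unfold W at g4
    obtain ⟨s, hs⟩ := card_pos.1 g4
    simp only [mem_filter, mem_univ, true_and] at hs
    have hlow := ih s.val hs.1 s.2
    have hall : ∀ j, ∀ i', i' + j < N → has (D s) (i'+j) → has (D s) i' := by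
      intro j
      induction j with
      | zero => intro i' _ h; exact h
      | succ j ihj =>
        intro i' hi' h
        apply ihj i' (by omega)
        exact hlow _ (by omega) h
    have hF : ∀ j, j ≤ i + 1 → F (D s) j = j := by
      intro j hj
      induction j with
      | zero => simp [F_zero]
      | succ j ihj =>
        rw [F_succ, ihj (by omega), e_eq_one.2]
        · push_cast; ring
        · apply hall (i - j) j (by omega)
          rw [show j + (i - j) = i by omega]; exact hs.2
    have h3 := hF (i+1) le_rfl
    have h4 := hc s ⟨t, ht⟩ (by rw [Fin.le_def]; exact hs.1.le) (by omega) (i+1)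
    have h5 := F_succ (D ⟨t, ht⟩) i
    rw [e_eq_zero.2 h2] at h5
    have h6 := F_le (D ⟨t, ht⟩) i
    push_cast at h3
    omega

def seg (N a : ℕ) : Finset (Fin N) := univ.filter fun x => x.val < a

lemma has_seg (a i : ℕ) : has (seg N a) i ↔ i < N ∧ i < a := by
  unfold has seg
  simp

lemma card_seg (a : ℕ) (ha : a ≤ N) : (seg N a).card = a := by
  have : seg N a = (univ : Finset (Fin a)).map (Fin.castLEEmb ha) := by
    ext x
    simp only [seg, mem_filter, mem_univ, true_and, mem_map, Fin.castLEEmb_apply]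
    constructor
    · intro h; exact ⟨⟨x, h⟩, rfl⟩
    · rintro ⟨y, rfl⟩; simp
  rw [this]; simp

lemma eq_seg {A : Finset (Fin N)} (h : ∀ i, i + 1 < N → has A (i+1) → has A i) : A = seg N A.card := by
  have hall : ∀ j, ∀ i', i' + j < N → has A (i'+j) → has A i' := by
    intro j
    induction j with
    | zero => intro i' _ h; exact h
    | succ j ihj =>
      intro i' hi' hh
      apply ihj i' (by omega)
      exact h _ (by omega) hh
  symm
  apply eq_of_subset_of_card_le
  · intro x hx
    by_contra hxA
    have : A ⊆ seg N x.val := by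
      intro y hy
      simp only [seg, mem_filter, mem_univ, true_and]
      by_contra hyx
      apply hxA
      rw [← has_val]
      apply hall (y.val - x.val) x.val (by omega)
      rw [show x.val + (y.val - x.val) = y.val by omega, has_val]; exact hy
    have h1 := card_le_card this
    rw [card_seg _ (by omega)] at h1
    simp only [seg, mem_filter, mem_univ, true_and] at hx
    omega
  · rw [card_seg]
    simpa using card_le_univ A

lemma F_seg_mono {a b : ℕ} (h : a ≤ b) (i : ℕ) : F (seg N a) i ≤ F (seg N b) i := by
  unfold F
  apply sum_le_sum
  intro j _
  by_cases h1 : has (seg N a) j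
  · rw [e_eq_one.2 h1, e_eq_one.2]
    rw [has_seg] at h1 ⊢
    omega
  · rw [e_eq_zero.2 h1]; exact e_nonneg _ _

theorem tq_one_eq (α : Fin T → ℕ) (hm : Monotone α) (hN : ∀ s, α s ≤ N) (mu : ℕ → ℕ)
    (hmu : ∀ i, i < N → mu i = (univ.filter fun s => i < α s).card) :
    tq N 1 α = skewSchur N N mu (fun _ => 0) := by
  classical
  rw [tq_eq_sum 1 le_rfl (by omega)]
  have hW : ∀ t i, W (fun s : Fin T => seg N (α s)) t i =
      (univ.filter fun s : Fin T => s.val < t ∧ (i < N ∧ i < α s)).card := by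
    intro t i
    unfold W
    simp only [has_seg]
  have : (base N 1 α).filter Yam = {fun s => seg N (α s)} := by
    ext D
    simp only [mem_filter, mem_singleton, mem_base]
    constructor
    · rintro ⟨⟨h1, h2⟩, h3⟩
      funext s
      have := eq_seg (lower_of_yam h1 h3 s.val s.2)
      rw [h2] at this
      exact this
    · rintro rfl
      refine ⟨⟨fun s t hst _ i => F_seg_mono (hm hst) i, fun s => card_seg _ (hN s)⟩, ?_⟩
      intro s _ i hi
      rw [hW, hW]
      apply card_le_card
      intro r
      simp only [mem_filter, mem_univ, true_and]
      omega
  rw [this, sum_singleton, skew_eq, skew_eq]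
  congr 1
  unfold hmat
  congr 1
  funext i j
  have : W (fun s : Fin T => seg N (α s)) T i = mu i := by
    rw [hW, hmu i i.2]
    congr 1
    apply filter_congr
    intro s _
    have := s.2
    have := i.2
    constructor
    · intro h; exact h.2.2
    · intro h; exact ⟨‹_›, ‹_›, h⟩
  simp only [this]

/-- lengths of columns of `mu`, padded to `T` columns, in increasing order -/
def conj (T k : ℕ) (mu : ℕ → ℕ) (s : Fin T) : ℕ := ((range k).filter fun r => T - 1 - s < mu r).card

lemma lt_conj (k : ℕ) (mu : ℕ → ℕ) (hm : Antitone mu) (hk : ∀ j, k ≤ j → mu j = 0) (s : Fin T) (i : ℕ) :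
    i < conj T k mu s ↔ T - 1 - s < mu i := by
  unfold conj
  constructor
  · intro h
    by_contra hc
    have : (range k).filter (fun r => T - 1 - s < mu r) ⊆ range i := by
      intro r
      simp only [mem_filter, mem_range]
      rintro ⟨_, h2⟩
      by_contra hr
      have := hm (show i ≤ r by omega)
      omega
    have := card_le_card this
    rw [card_range] at this
    omega
  · intro h
    have : range (i+1) ⊆ (range k).filter (fun r => T - 1 - s < mu r) := by
      intro r
      simp only [mem_filter, mem_range]
      intro hr
      have := hm (show r ≤ i by omega)
      refine ⟨?_, by omega⟩
      by_contra hc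
      have := hk r (by omega)
      omega
    have := card_le_card this
    rw [card_range] at this
    omega

theorem schur_eq_tq (k : ℕ) (mu : ℕ → ℕ) (hm : Antitone mu) (hk : ∀ j, k ≤ j → mu j = 0)
    (hT : mu 0 ≤ T) : skewSchur N k mu (fun _ => 0) = tq N 1 (conj T k mu) := by
  have hl := lt_conj (T := T) k mu hm hk
  rcases Nat.eq_zero_or_pos (mu N) with h0 | h0
  · have hz : ∀ j, N ≤ j → mu j = 0 := fun j hj => by have := hm hj; omega
    have h1 : skewSchur N k mu (fun _ => 0) = skewSchur N N mu (fun _ => 0) := by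
      rcases le_total k N with h | h
      · rw [skew_stable_le k N h mu hk]
      · rw [skew_stable_le N k h mu hz]
    rw [h1]
    symm
    apply tq_one_eq
    · intro s t hst
      by_contra hc
      have h1 := (hl s (conj T k mu t)).1 (by omega)
      have h2 := (hl t (conj T k mu t)).2 (by have : s.val ≤ t.val := hst; omega)
      omega
    · intro s
      by_contra hc
      have := (hl s N).1 (by omega)
      omega
    · intro i _
      simp only [hl]
      have hi : mu i ≤ T := (hm (Nat.zero_le i)).trans hT
      have : (univ.filter fun s : Fin T => T - 1 - s.val < mu i) =
          (univ.filter fun s : Fin T => s.val < mu i).map Fin.revPerm.toEmbedding := by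
        ext s
        simp only [mem_filter, mem_univ, true_and, mem_map_equiv, Fin.revPerm_symm, Fin.revPerm_apply,
          Fin.val_rev]
        have := s.2
        omega
      rw [this, card_map]
      exact (card_seg (N := T) (mu i) hi).symm
  · have hkN : N < k := by
      by_contra h; have := hk N (by omega); omega
    have hTN : mu N ≤ mu 0 := hm (Nat.zero_le _)
    have e1 : tq N 1 (conj T k mu) = 0 := by
      unfold tq
      rw [show base N 1 (conj T k mu) = ∅ from ?_, sum_empty]
      rw [eq_empty_iff_forall_notMem]
      intro D hD
      have h1 := (mem_base.1 hD).2 ⟨T-1, by omega⟩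
      have h2 := (hl ⟨T-1, by omega⟩ N).2 (by simp; omega)
      have h3 := card_le_univ (D ⟨T-1, by omega⟩)
      rw [Fintype.card_fin] at h3
      omega
    rw [e1]
    obtain ⟨d, rfl⟩ : ∃ d, k = N + 1 + d := ⟨k - N - 1, by omega⟩
    clear e1 hl hT hTN hkN
    induction d with
    | zero => exact skew_vanish N le_rfl mu hm h0
    | succ d ih =>
      rcases Nat.eq_zero_or_pos (mu (N + 1 + d)) with h1 | h1
      · rw [← add_assoc, skew_stable _ _ h1]
        exact ih (fun j hj => by have := hm hj; omega)
      · exact skew_vanish (N+1+d) (by omega) mu hm h1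

/-! ### Interleaving two chains -/

def inter {X : Type*} {n : ℕ} (A B : Fin n → X) (t : Fin (n*2)) : X :=
  if t.val % 2 = 0 then A ⟨t.val / 2, by omega⟩ else B ⟨t.val / 2, by omega⟩

variable {n : ℕ}

lemma inter_even {X : Type*} (A B : Fin n → X) (c : ℕ) (hc : c < n) (h : 2 * c < n * 2) :
    inter A B ⟨2*c, h⟩ = A ⟨c, hc⟩ := by
  unfold inter
  rw [if_pos (by simp)]
  congr 2
  simp

lemma inter_odd {X : Type*} (A B : Fin n → X) (c : ℕ) (hc : c < n) (h : 2 * c + 1 < n * 2) :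
    inter A B ⟨2*c+1, h⟩ = B ⟨c, hc⟩ := by
  unfold inter
  rw [if_neg (by simp)]
  congr 2
  simp only
  omega

lemma forall_fin2 {P : Fin (n*2) → Prop} : (∀ t, P t) ↔
    (∀ c : Fin n, P ⟨2*c, by omega⟩) ∧ ∀ c : Fin n, P ⟨2*c+1, by omega⟩ := by
  constructor
  · intro h; exact ⟨fun c => h _, fun c => h _⟩
  · rintro ⟨h1, h2⟩ t
    have ht := t.2
    rcases Nat.even_or_odd' t.val with ⟨c, hc | hc⟩
    · have := h1 ⟨c, by omega⟩
      convert this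
    · have := h2 ⟨c, by omega⟩
      convert this

lemma inter_chn (A B : Fin n → Finset (Fin N)) : Chn 2 (inter A B) ↔ Chn 1 A ∧ Chn 1 B := by
  unfold Chn
  constructor
  · intro h
    constructor
    · intro s t hst _ i
      have := h ⟨2*s, by omega⟩ ⟨2*t, by omega⟩ (by
        rw [Fin.le_def] at *; simp only; omega) (by simp) i
      rwa [inter_even _ _ _ s.2, inter_even _ _ _ t.2] at this
    · intro s t hst _ i
      have := h ⟨2*s+1, by omega⟩ ⟨2*t+1, by omega⟩ (by
        rw [Fin.le_def] at *; simp only; omega) (by simp only; omega) i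
      rwa [inter_odd _ _ _ s.2, inter_odd _ _ _ t.2] at this
  · rintro ⟨hA, hB⟩ s t hst hq i
    have hst' : s.val ≤ t.val := hst
    unfold inter
    rw [← hq]
    split_ifs
    · exact hA _ _ (by rw [Fin.le_def]; simp only; omega) (by omega) i
    · exact hB _ _ (by rw [Fin.le_def]; simp only; omega) (by omega) i

lemma W_inter (A B : Fin n → Finset (Fin N)) (c i : ℕ) (hc : c ≤ n) :
    W (inter A B) (2*c) i = W A c i + W B c i := by
  classical
  induction c with
  | zero => simp [W_zero]
  | succ c ih =>
    rw [show 2 * (c+1) = 2*c+1+1 by ring, W_succ _ _ (by omega), W_succ _ _ (by omega), ih (by omega),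
      W_succ A c (by omega), W_succ B c (by omega), inter_even _ _ _ (by omega), inter_odd _ _ _ (by omega)]
    ring

lemma W_inter' (A B : Fin n → Finset (Fin N)) (c i : ℕ) (hc : c < n) :
    W (inter A B) (2*c+1) i = W A (c+1) i + W B c i := by
  classical
  rw [W_succ _ _ (by omega), W_inter _ _ _ _ hc.le, W_succ A c hc, inter_even _ _ _ hc]
  ring

lemma base_inter (α β : Fin n → ℕ) (A B : Fin n → Finset (Fin N)) :
    inter A B ∈ base N 2 (inter α β) ↔ A ∈ base N 1 α ∧ B ∈ base N 1 β := by
  simp only [mem_base, inter_chn]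
  rw [forall_fin2]
  have h1 : ∀ c : Fin n, (inter A B ⟨2*c, by omega⟩) = A c := fun c => inter_even _ _ _ c.2 _
  have h2 : ∀ c : Fin n, (inter A B ⟨2*c+1, by omega⟩) = B c := fun c => inter_odd _ _ _ c.2 _
  have h3 : ∀ c : Fin n, (inter α β ⟨2*c, by omega⟩) = α c := fun c => inter_even _ _ _ c.2 _
  have h4 : ∀ c : Fin n, (inter α β ⟨2*c+1, by omega⟩) = β c := fun c => inter_odd _ _ _ c.2 _
  simp only [h1, h2, h3, h4]
  tauto

lemma inter_surj {X : Type*} (D : Fin (n*2) → X) :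
    inter (fun c : Fin n => D ⟨2*c, by omega⟩) (fun c : Fin n => D ⟨2*c+1, by omega⟩) = D := by
  funext t
  revert t
  rw [forall_fin2]
  constructor
  · intro c; rw [inter_even _ _ _ c.2]
  · intro c; rw [inter_odd _ _ _ c.2]

lemma inter_inj {X : Type*} {A B A' B' : Fin n → X} (h : inter A B = inter A' B') : A = A' ∧ B = B' := by
  constructor
  · funext c
    have := congrFun h ⟨2*c, by omega⟩
    rwa [inter_even _ _ _ c.2, inter_even _ _ _ c.2] at this
  · funext c
    have := congrFun h ⟨2*c+1, by omega⟩
    rwa [inter_odd _ _ _ c.2, inter_odd _ _ _ c.2] at this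

lemma tq_mul (α β : Fin n → ℕ) : tq N 1 α * tq N 1 β = tq N 2 (inter α β) := by
  unfold tq
  rw [sum_mul_sum, ← sum_product']
  refine sum_bij (fun p _ => inter p.1 p.2) ?_ ?_ ?_ ?_
  · intro p hp
    rw [base_inter]
    exact mem_product.1 hp
  · intro p _ p' _ h
    exact Prod.ext (inter_inj h).1 (inter_inj h).2
  · intro D hD
    refine ⟨(fun c : Fin n => D ⟨2*c, by omega⟩, fun c : Fin n => D ⟨2*c+1, by omega⟩), ?_, inter_surj D⟩
    rw [mem_product, ← base_inter, inter_surj]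
    exact hD
  · intro p _
    unfold mon
    rw [← prod_mul_distrib]
    apply prod_congr rfl
    intro v _
    rw [← pow_add]
    congr 1
    have := W_inter p.1 p.2 n v le_rfl
    rw [mul_comm 2 n] at this
    exact this.symm

lemma SP_mul {f g : MvPolynomial (Fin N) ℤ} (hf : f ∈ SP N) (hg : g ∈ SP N) : f * g ∈ SP N := by
  have key : ∀ f ∈ SS N, ∀ g ∈ SS N, f * g ∈ SP N := by
    rintro _ ⟨k, lam, h1, h2, rfl⟩ _ ⟨k', lam', h1', h2', rfl⟩
    rw [schur_eq_tq (T := lam 0 + lam' 0) k lam h1 h2 (by omega),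
      schur_eq_tq (T := lam 0 + lam' 0) k' lam' h1' h2' (by omega), tq_mul]
    exact tq_mem 2 (by omega) le_rfl _
  unfold SP at hf hg
  induction hf using AddSubmonoid.closure_induction with
  | mem f hf =>
    induction hg using AddSubmonoid.closure_induction with
    | mem g hg => exact key f hf g hg
    | zero => rw [mul_zero]; exact zero_mem _
    | add x y _ _ hx hy => rw [mul_add]; exact add_mem hx hy
  | zero => rw [zero_mul]; exact zero_mem _
  | add x y _ _ hx hy => rw [add_mul]; exact add_mem hx hy

end LLT

end

section
namespace LLT

/-! ### Comparison and interpolation -/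

lemma cmp_concave {N : ℕ} {P : ℕ → Prop} {φ ψ : ℕ → ℤ} (P0 : P 0) (PN : P N)
    (hφ : ∀ i < N, 0 ≤ φ (i+1) - φ i ∧ φ (i+1) - φ i ≤ 1)
    (hψ : ∀ i < N, 0 ≤ ψ (i+1) - ψ i ∧ ψ (i+1) - ψ i ≤ 1)
    (hc : ∀ i, i + 2 ≤ N → ¬ P (i+1) → φ i + φ (i+2) ≤ 2 * φ (i+1))
    (h : ∀ i ≤ N, P i → ψ i ≤ φ i) : ∀ i ≤ N, ψ i ≤ φ i := by
  have down : ∀ i, i < N → φ (i+1) - φ i = 1 → ψ i ≤ φ i := by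
    intro i
    induction i with
    | zero => intro _ _; exact h 0 (by omega) P0
    | succ i ih =>
      intro hi hs
      by_cases hp : P (i+1)
      · exact h _ (by omega) hp
      have h1 := hc i (by omega) hp
      have h2 := hφ i (by omega)
      have h3 := hψ i (by omega)
      have h4 := ih (by omega) (by rw [show i + 1 + 1 = i + 2 by ring] at hs; omega)
      rw [show i + 1 + 1 = i + 2 by ring] at hs
      omega
  have up : ∀ d i, i + 1 + d = N → φ (i+1) - φ i = 0 → ψ (i+1) ≤ φ (i+1) := by
    intro d
    induction d with
    | zero => intro i hi _; rw [show i + 1 = N by omega]; exact h N le_rfl PN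
    | succ d ih =>
      intro i hi hs
      by_cases hp : P (i+1)
      · exact h _ (by omega) hp
      have h1 := hc i (by omega) hp
      have h2 := hφ (i+1) (by omega)
      have h3 := hψ (i+1) (by omega)
      rw [show i + 1 + 1 = i + 2 by ring] at h2 h3
      have h4 := ih (i+1) (by omega) (by rw [show i + 1 + 1 = i + 2 by ring]; omega)
      rw [show i + 1 + 1 = i + 2 by ring] at h4
      omega
  intro i hi
  rcases Nat.eq_or_lt_of_le hi with rfl | hlt
  · exact h _ le_rfl PN
  have h2 := hφ i hlt
  have h3 := hψ i hlt
  by_cases hs : φ (i+1) - φ i = 1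
  · exact down i hlt hs
  · have := up (N - i - 1) i (by omega) (by omega)
    omega

lemma cmp_convex {N : ℕ} {P : ℕ → Prop} {φ ψ : ℕ → ℤ} (P0 : P 0) (PN : P N)
    (hφ : ∀ i < N, 0 ≤ φ (i+1) - φ i ∧ φ (i+1) - φ i ≤ 1)
    (hψ : ∀ i < N, 0 ≤ ψ (i+1) - ψ i ∧ ψ (i+1) - ψ i ≤ 1)
    (hc : ∀ i, i + 2 ≤ N → ¬ P (i+1) → 2 * φ (i+1) ≤ φ i + φ (i+2))
    (h : ∀ i ≤ N, P i → φ i ≤ ψ i) : ∀ i ≤ N, φ i ≤ ψ i := by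
  intro i hi
  have := cmp_concave (φ := fun i => (i:ℤ) - φ i) (ψ := fun i => (i:ℤ) - ψ i) P0 PN
    (fun i hi => by have := hφ i hi; push_cast; omega)
    (fun i hi => by have := hψ i hi; push_cast; omega)
    (fun i hi hp => by have := hc i hi hp; push_cast; omega)
    (fun i hi hp => by have := h i hi hp; omega) i hi
  omega

lemma interp (N : ℕ) (P : ℕ → Prop) (φ : ℕ → ℤ) (P0 : P 0)
    (h : ∀ i j, i < j → j ≤ N → P i → P j → 0 ≤ φ j - φ i ∧ φ j - φ i ≤ j - i) :
    ∃ ψ : ℕ → ℤ, (∀ i < N, 0 ≤ ψ (i+1) - ψ i ∧ ψ (i+1) - ψ i ≤ 1) ∧ (∀ i ≤ N, P i → ψ i = φ i) ∧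
      ∀ i, i + 2 ≤ N → ¬ P (i+1) → ψ i + ψ (i+2) ≤ 2 * ψ (i+1) := by
  classical
  set s := (range (N+1)).filter P with hs
  have hne : s.Nonempty := ⟨0, by simp [hs, P0]⟩
  let w : ℕ → ℕ → ℤ := fun i x => φ x + ((i - x : ℕ) : ℤ)
  let ψ : ℕ → ℤ := fun i => s.inf' hne (w i)
  have le : ∀ i x, x ≤ N → P x → ψ i ≤ φ x + ((i - x : ℕ) : ℤ) := by
    intro i x hx hp
    exact inf'_le (w i) (by simp [hs, hp]; omega)
  have att : ∀ i, ∃ x ≤ N, P x ∧ ψ i = φ x + ((i - x : ℕ) : ℤ) := by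
    intro i
    obtain ⟨x, hx, hx2⟩ := exists_mem_eq_inf' hne (w i)
    simp only [hs, mem_filter, mem_range] at hx
    exact ⟨x, by omega, hx.2, hx2⟩
  refine ⟨ψ, ?_, ?_, ?_⟩
  · intro i _
    obtain ⟨x, hx, hp, hx2⟩ := att i
    obtain ⟨y, hy, hq, hy2⟩ := att (i+1)
    have h1 := le (i+1) x hx hp
    have h2 := le i y hy hq
    omega
  · intro i hi hp
    have h1 := le i i hi hp
    obtain ⟨x, hx, hq, hx2⟩ := att i
    rcases lt_trichotomy x i with h' | h' | h'
    · have := h x i h' hi hq hp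
      omega
    · subst h'; omega
    · have := h i x h' hx hp hq
      omega
  · intro i hi hp
    obtain ⟨x, hx, hq, hx2⟩ := att (i+1)
    have hne : x ≠ i + 1 := by rintro rfl; exact hp hq
    have h1 := le i x hx hq
    have h2 := le (i+2) x hx hq
    omega

lemma affine_up {N : ℕ} {P : ℕ → Prop} {σ : ℕ → ℤ} (PN : P N)
    (hc : ∀ i, i + 2 ≤ N → ¬ P (i+1) → σ i + σ (i+2) = 2 * σ (i+1)) :
    ∀ d i, i + 1 + d = N → ∃ r, i < r ∧ r ≤ N ∧ P r ∧ σ r - σ i = (r - i) * (σ (i+1) - σ i) := by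
  intro d
  induction d with
  | zero =>
    intro i hi
    refine ⟨i+1, by omega, by omega, ?_, by push_cast; ring⟩
    rw [show i + 1 = N by omega]; exact PN
  | succ d ih =>
    intro i hi
    by_cases hp : P (i+1)
    · exact ⟨i+1, by omega, by omega, hp, by push_cast; ring⟩
    · obtain ⟨r, h1, h2, h3, h4⟩ := ih (i+1) (by omega)
      refine ⟨r, by omega, h2, h3, ?_⟩
      have h5 := hc i (by omega) hp
      rw [show i + 1 + 1 = i + 2 by ring] at h4
      push_cast at h4
      have h6 : σ (i+2) = 2 * σ (i+1) - σ i := by omega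
      rw [h6] at h4
      linear_combination h4

lemma affine_down {N : ℕ} {P : ℕ → Prop} {σ : ℕ → ℤ} (P0 : P 0)
    (hc : ∀ i, i + 2 ≤ N → ¬ P (i+1) → σ i + σ (i+2) = 2 * σ (i+1)) :
    ∀ i, i < N → ∃ r, r ≤ i ∧ P r ∧ σ (i+1) - σ r = (i + 1 - r) * (σ (i+1) - σ i) := by
  intro i
  induction i with
  | zero => intro _; exact ⟨0, le_rfl, P0, by simp⟩
  | succ i ih =>
    intro hi
    by_cases hp : P (i+1)
    · exact ⟨i+1, le_rfl, hp, by push_cast; ring⟩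
    · obtain ⟨r, h1, h3, h4⟩ := ih (by omega)
      refine ⟨r, by omega, h3, ?_⟩
      have h5 := hc i (by omega) hp
      rw [show i + 1 + 1 = i + 2 by ring]
      have h6 : σ i = 2 * σ (i+1) - σ (i+2) := by omega
      rw [h6] at h4
      push_cast
      linear_combination h4

/-! ### Pairs of chains as lattice functions -/

def SSum (f g : ℕ → ℕ → ℤ) (c i : ℕ) : ℤ := ∑ d ∈ range c, (f d i + g d i)

lemma SSum_succ (f g : ℕ → ℕ → ℤ) (c i : ℕ) : SSum f g (c+1) i = SSum f g c i + (f c i + g c i) := by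
  simp [SSum, sum_range_succ]

structure Good (n N : ℕ) (f g : ℕ → ℕ → ℤ) : Prop where
  f0 : ∀ c < n, f c 0 = 0
  g0 : ∀ c < n, g c 0 = 0
  fs : ∀ c < n, ∀ i < N, 0 ≤ f c (i+1) - f c i ∧ f c (i+1) - f c i ≤ 1
  gs : ∀ c < n, ∀ i < N, 0 ≤ g c (i+1) - g c i ∧ g c (i+1) - g c i ≤ 1
  fc : ∀ c, c + 1 < n → ∀ i ≤ N, f c i ≤ f (c+1) i
  gc : ∀ c, c + 1 < n → ∀ i ≤ N, g c i ≤ g (c+1) i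
  y1 : ∀ c < n, ∀ i, i + 2 ≤ N →
    SSum f g c i + f c i + (SSum f g c (i+2) + f c (i+2)) ≤ 2 * (SSum f g c (i+1) + f c (i+1))
  y2 : ∀ c ≤ n, ∀ i, i + 2 ≤ N → SSum f g c i + SSum f g c (i+2) ≤ 2 * SSum f g c (i+1)

def Bp (N : ℕ) (f g : ℕ → ℕ → ℤ) (c i : ℕ) : Prop :=
  i = 0 ∨ i = N ∨ ∃ j, i = j + 1 ∧ j + 2 ≤ N ∧ SSum f g c j + SSum f g c (j+2) < 2 * SSum f g c (j+1)

lemma Bp_zero {N : ℕ} {f g : ℕ → ℕ → ℤ} {c : ℕ} : Bp N f g c 0 := Or.inl rfl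
lemma Bp_N {N : ℕ} {f g : ℕ → ℕ → ℤ} {c : ℕ} : Bp N f g c N := Or.inr (Or.inl rfl)
lemma Bp_le {N : ℕ} {f g : ℕ → ℕ → ℤ} {c i : ℕ} (h : Bp N f g c i) : i ≤ N := by
  rcases h with h | h | ⟨j, h, _⟩ <;> omega

lemma Bp_affine {n N : ℕ} {f g : ℕ → ℕ → ℤ} (G : Good n N f g) {c i : ℕ} (hc : c ≤ n) (hi : i + 2 ≤ N)
    (h : ¬ Bp N f g c (i+1)) : SSum f g c i + SSum f g c (i+2) = 2 * SSum f g c (i+1) := by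
  have h1 := G.y2 c hc i hi
  by_contra h2
  exact h (Or.inr (Or.inr ⟨i, rfl, hi, by omega⟩))

lemma Bp_strict {N : ℕ} {f g : ℕ → ℕ → ℤ} {c i : ℕ} (hi : i + 2 ≤ N)
    (h : Bp N f g c (i+1)) : SSum f g c i + SSum f g c (i+2) < 2 * SSum f g c (i+1) := by
  rcases h with h | h | ⟨j, h1, h2, h3⟩
  · omega
  · omega
  · have : i = j := by omega
    subst this; exact h3

lemma f_concave {n N : ℕ} {f g : ℕ → ℕ → ℤ} (G : Good n N f g) {c i : ℕ} (hc : c < n) (hi : i + 2 ≤ N)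
    (h : ¬ Bp N f g c (i+1)) : f c i + f c (i+2) ≤ 2 * f c (i+1) := by
  have h1 := Bp_affine G hc.le hi h
  have h2 := G.y1 c hc i hi
  omega

def Nd (N : ℕ) (f g : ℕ → ℕ → ℤ) (c i : ℕ) : Prop := Bp N f g c i ∨ Bp N f g (c+1) i

def Mx (k : ℤ) (f g : ℕ → ℕ → ℤ) (c i : ℕ) : ℤ := max (f c i) (g c i + k)
def Mn (k : ℤ) (f g : ℕ → ℕ → ℤ) (c i : ℕ) : ℤ := min (f c i) (g c i + k)

def Lk (n N : ℕ) (k : ℤ) (f g : ℕ → ℕ → ℤ) (c i d j : ℕ) : Prop :=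
  (c = d ∧ c < n ∧ i < j ∧ Nd N f g c i ∧ Nd N f g c j ∧
    (Mn k f g c j < Mx k f g c i ∨ (j : ℤ) - i < Mx k f g c j - Mn k f g c i)) ∨
  (d = c + 1 ∧ c + 1 < n ∧ j = i ∧ Bp N f g (c+1) i ∧ Mn k f g (c+1) i < Mx k f g c i)

inductive Zr (n N : ℕ) (k : ℤ) (f g : ℕ → ℕ → ℤ) (tb : ℕ → Prop) : ℕ → ℕ → Prop
  | top (c : ℕ) : c < n → tb c → Zr n N k f g tb c N
  | step (c i d j : ℕ) : Zr n N k f g tb c i → (Lk n N k f g c i d j ∨ Lk n N k f g d j c i) →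
      Zr n N k f g tb d j

lemma mono_of_step {N : ℕ} {φ : ℕ → ℤ} (h : ∀ i < N, 0 ≤ φ (i+1) - φ i ∧ φ (i+1) - φ i ≤ 1)
    (i j : ℕ) (hij : i ≤ j) (hj : j ≤ N) : 0 ≤ φ j - φ i ∧ φ j - φ i ≤ j - i := by
  induction j, hij using Nat.le_induction with
  | base => simp
  | succ j hij ih =>
    have := ih (by omega)
    have := h j (by omega)
    push_cast
    omega

lemma Nd_le {N : ℕ} {f g : ℕ → ℕ → ℤ} {c i : ℕ} (h : Nd N f g c i) : i ≤ N := by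
  rcases h with h | h <;> exact Bp_le h

lemma Zr_prop {n N : ℕ} {k : ℤ} {f g : ℕ → ℕ → ℤ} {tb : ℕ → Prop} (G : Good n N f g)
    (ht : ∀ c < n, tb c → g c N + k < f c N) {c i : ℕ} (h : Zr n N k f g tb c i) :
    c < n ∧ g c i + k < f c i := by
  induction h with
  | top c hc hb => exact ⟨hc, ht c hc hb⟩
  | step c i d j _ hl ih =>
    obtain ⟨hc, hgt⟩ := ih
    rcases hl with (⟨rfl, _, hij, n1, n2, hh⟩ | ⟨rfl, hd, rfl, hb, hh⟩) |
      (⟨rfl, _, hij, n1, n2, hh⟩ | ⟨rfl, hd, rfl, hb, hh⟩)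
    · refine ⟨hc, ?_⟩
      by_contra hle
      have a1 := mono_of_step (G.fs c hc) i j hij.le (Nd_le n2)
      have a2 := mono_of_step (G.gs c hc) i j hij.le (Nd_le n2)
      unfold Mx Mn at hh
      omega
    · refine ⟨hd, ?_⟩
      by_contra hle
      have a1 := G.fc c hd j (Bp_le hb)
      unfold Mx Mn at hh
      omega
    · refine ⟨hc, ?_⟩
      by_contra hle
      have a1 := mono_of_step (G.fs d hc) j i hij.le (Nd_le n2)
      have a2 := mono_of_step (G.gs d hc) j i hij.le (Nd_le n2)
      unfold Mx Mn at hh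
      omega
    · refine ⟨by omega, ?_⟩
      by_contra hle
      have a1 := G.gc d hd i (Bp_le hb)
      unfold Mx Mn at hh
      omega

open Classical in
noncomputable def fst (n N : ℕ) (k : ℤ) (f g : ℕ → ℕ → ℤ) (tb : ℕ → Prop) (c i : ℕ) : ℤ :=
  if Zr n N k f g tb c i then g c i + k else f c i

lemma SSum_congr {n N : ℕ} {f g f' g' : ℕ → ℕ → ℤ} (h : ∀ c < n, ∀ i ≤ N, f' c i + g' c i = f c i + g c i)
    (c i : ℕ) (hc : c ≤ n) (hi : i ≤ N) : SSum f' g' c i = SSum f g c i := by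
  unfold SSum
  apply sum_congr rfl
  intro d hd
  simp only [mem_range] at hd
  exact h d (by omega) i hi

lemma Bp_congr {n N : ℕ} {f g f' g' : ℕ → ℕ → ℤ} (h : ∀ c < n, ∀ i ≤ N, f' c i + g' c i = f c i + g c i)
    (c i : ℕ) (hc : c ≤ n) : Bp N f' g' c i ↔ Bp N f g c i := by
  have key := SSum_congr h
  unfold Bp
  apply or_congr Iff.rfl
  apply or_congr Iff.rfl
  apply exists_congr
  intro j
  apply and_congr_right
  intro _
  apply and_congr_right
  intro hj
  rw [key c j hc (by omega), key c (j+1) hc (by omega), key c (j+2) hc (by omega)]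

/-- coarse data of the flipped pair -/
lemma fst_steps {n N : ℕ} {k : ℤ} {f g : ℕ → ℕ → ℤ} {tb : ℕ → Prop} (G : Good n N f g)
    (c i j : ℕ) (hc : c < n) (hij : i < j) (hi : Nd N f g c i) (hj : Nd N f g c j) :
    (0 ≤ fst n N k f g tb c j - fst n N k f g tb c i ∧
      fst n N k f g tb c j - fst n N k f g tb c i ≤ j - i) ∧
    (0 ≤ (f c j + g c j - fst n N k f g tb c j) - (f c i + g c i - fst n N k f g tb c i) ∧
      (f c j + g c j - fst n N k f g tb c j) - (f c i + g c i - fst n N k f g tb c i) ≤ j - i) := by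
  have a1 := mono_of_step (G.fs c hc) i j hij.le (Nd_le hj)
  have a2 := mono_of_step (G.gs c hc) i j hij.le (Nd_le hj)
  unfold fst
  have key : ¬ (Zr n N k f g tb c i ↔ Zr n N k f g tb c j) →
      ¬ (Mn k f g c j < Mx k f g c i ∨ (j : ℤ) - i < Mx k f g c j - Mn k f g c i) := by
    intro hne hl
    have hlk : Lk n N k f g c i c j := Or.inl ⟨rfl, hc, hij, hi, hj, hl⟩
    exact hne ⟨fun h => Zr.step _ _ _ _ h (Or.inl hlk), fun h => Zr.step _ _ _ _ h (Or.inr hlk)⟩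
  by_cases h1 : Zr n N k f g tb c i <;> by_cases h2 : Zr n N k f g tb c j
  · simp only [h1, h2, if_true]; omega
  · have := key (by tauto)
    unfold Mx Mn at this
    simp only [h1, h2, if_true, if_false]; omega
  · have := key (by tauto)
    unfold Mx Mn at this
    simp only [h1, h2, if_true, if_false]; omega
  · simp only [h1, h2, if_false]; omega

lemma fst_chain {n N : ℕ} {k : ℤ} {f g : ℕ → ℕ → ℤ} {tb : ℕ → Prop} (G : Good n N f g)
    (c i : ℕ) (hc : c + 1 < n) (hi : Bp N f g (c+1) i) :
    fst n N k f g tb c i ≤ fst n N k f g tb (c+1) i ∧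
    (f c i + g c i - fst n N k f g tb c i) ≤ (f (c+1) i + g (c+1) i - fst n N k f g tb (c+1) i) := by
  have a1 := G.fc c hc i (Bp_le hi)
  have a2 := G.gc c hc i (Bp_le hi)
  unfold fst
  have key : ¬ (Zr n N k f g tb c i ↔ Zr n N k f g tb (c+1) i) →
      ¬ (Mn k f g (c+1) i < Mx k f g c i) := by
    intro hne hl
    have hlk : Lk n N k f g c i (c+1) i := Or.inr ⟨rfl, hc, rfl, hi, hl⟩
    exact hne ⟨fun h => Zr.step _ _ _ _ h (Or.inl hlk), fun h => Zr.step _ _ _ _ h (Or.inr hlk)⟩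
  by_cases h1 : Zr n N k f g tb c i <;> by_cases h2 : Zr n N k f g tb (c+1) i
  · simp only [h1, h2, if_true]; omega
  · have := key (by tauto)
    unfold Mx Mn at this
    simp only [h1, h2, if_true, if_false]; omega
  · have := key (by tauto)
    unfold Mx Mn at this
    simp only [h1, h2, if_true, if_false]; omega
  · simp only [h1, h2, if_false]; omega

theorem flip_exists {n N : ℕ} {k : ℤ} {f g : ℕ → ℕ → ℤ} {tb : ℕ → Prop} (hk : 0 ≤ k) (G : Good n N f g)
    (ht : ∀ c < n, tb c → f c N = g c N + k + 1) (ht' : ∀ c < n, ¬ tb c → f c N ≤ g c N + k) :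
    ∃ f' g' : ℕ → ℕ → ℤ, Good n N f' g' ∧ (∀ c < n, ∀ i ≤ N, f' c i + g' c i = f c i + g c i) ∧
      (∀ c < n, tb c → f' c N = f c N - 1 ∧ g' c N = g c N + 1) ∧
      (∀ c < n, ¬ tb c → f' c N = f c N ∧ g' c N = g c N) ∧
      (∀ c < n, ∀ i, Nd N f g c i → f' c i = fst n N k f g tb c i) := by
  have htz : ∀ c < n, tb c → g c N + k < f c N := fun c hc h => by have := ht c hc h; omega
  have hex : ∀ c, ∃ ψ : ℕ → ℤ, c < n → (∀ i < N, 0 ≤ ψ (i+1) - ψ i ∧ ψ (i+1) - ψ i ≤ 1) ∧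
      (∀ i ≤ N, Nd N f g c i → ψ i = fst n N k f g tb c i) ∧
      ∀ i, i + 2 ≤ N → ¬ Nd N f g c (i+1) → ψ i + ψ (i+2) ≤ 2 * ψ (i+1) := by
    intro c
    by_cases hc : c < n
    · obtain ⟨ψ, hψ⟩ := interp N (Nd N f g c) (fst n N k f g tb c) (Or.inl Bp_zero)
        (fun i j hij _ hi hj => (fst_steps G c i j hc hij hi hj).1)
      exact ⟨ψ, fun _ => hψ⟩
    · exact ⟨0, fun h => absurd h hc⟩
  choose f' hf' using hex
  set g' : ℕ → ℕ → ℤ := fun c i => f c i + g c i - f' c i with hg'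
  have hsum : ∀ c < n, ∀ i ≤ N, f' c i + g' c i = f c i + g c i := by
    intro c _ i _; simp only [hg']; ring
  have hS := SSum_congr hsum
  -- step facts
  have hstep : ∀ c < n, ∀ i < N, (f c (i+1) + g c (i+1) - (f c i + g c i) = 0 → f' c (i+1) = f' c i) ∧
      (f c (i+1) + g c (i+1) - (f c i + g c i) = 2 → f' c (i+1) = f' c i + 1) := by
    intro c hc i hi
    have haff : ∀ i, i + 2 ≤ N → ¬ Nd N f g c (i+1) →
        (f c i + g c i) + (f c (i+2) + g c (i+2)) = 2 * (f c (i+1) + g c (i+1)) := by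
      intro i hi hn
      unfold Nd at hn
      push Not at hn
      have b1 := Bp_affine G hc.le hi hn.1
      have b2 := Bp_affine G hc hi hn.2
      simp only [SSum_succ] at b2
      omega
    obtain ⟨r, r1, r2, r3, r4⟩ := affine_up (σ := fun i => f c i + g c i) (Or.inl Bp_N) haff
      (N - i - 1) i (by omega)
    obtain ⟨l, l1, l3, l4⟩ := affine_down (σ := fun i => f c i + g c i) (Or.inl Bp_zero) haff i hi

    have st := (fst_steps (k := k) (tb := tb) G c l r hc (by omega) l3 r3)
    obtain ⟨p1, p2, p3⟩ := hf' c hc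
    have q1 := p2 l (by omega) l3
    have q2 := p2 r r2 r3
    have m1 := mono_of_step p1 l i l1 (by omega)
    have m2 := mono_of_step p1 (i+1) r r1 r2
    have m3 := p1 i hi
    push_cast at m2
    constructor
    · intro h0
      rw [h0, mul_zero] at r4 l4
      omega
    · intro h2
      rw [h2] at r4 l4
      omega
  have hgs : ∀ c < n, ∀ i < N, 0 ≤ g' c (i+1) - g' c i ∧ g' c (i+1) - g' c i ≤ 1 := by
    intro c hc i hi
    have h1 := hstep c hc i hi
    have h2 := (hf' c hc).1 i hi
    have h3 := G.fs c hc i hi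
    have h4 := G.gs c hc i hi
    simp only [hg']
    omega
  have hy1 : ∀ c < n, ∀ i, i + 2 ≤ N →
      SSum f' g' c i + f' c i + (SSum f' g' c (i+2) + f' c (i+2)) ≤
        2 * (SSum f' g' c (i+1) + f' c (i+1)) := by
    intro c hc i hi
    rw [hS c i hc.le (by omega), hS c (i+1) hc.le (by omega), hS c (i+2) hc.le (by omega)]
    obtain ⟨p1, p2, p3⟩ := hf' c hc
    have m1 := p1 i (by omega)
    have m2 := p1 (i+1) (by omega)
    rw [show i + 1 + 1 = i + 2 by ring] at m2
    by_cases hb : Bp N f g c (i+1)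
    · have := Bp_strict hi hb
      omega
    · have b1 := Bp_affine G hc.le hi hb
      by_cases hb2 : Bp N f g (c+1) (i+1)
      · have b2 := Bp_strict hi hb2
        simp only [SSum_succ] at b2
        have s1 := hstep c hc i (by omega)
        have s2 := hstep c hc (i+1) (by omega)
        rw [show i + 1 + 1 = i + 2 by ring] at s2
        have h3 := G.fs c hc i (by omega)
        have h4 := G.gs c hc i (by omega)
        have h5 := G.fs c hc (i+1) (by omega)
        have h6 := G.gs c hc (i+1) (by omega)
        rw [show i + 1 + 1 = i + 2 by ring] at h5 h6
        omega
      · have := p3 i hi (by unfold Nd; tauto)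
        omega
  have hy2 : ∀ c ≤ n, ∀ i, i + 2 ≤ N → SSum f' g' c i + SSum f' g' c (i+2) ≤ 2 * SSum f' g' c (i+1) := by
    intro c hc i hi
    rw [hS c i hc (by omega), hS c (i+1) hc (by omega), hS c (i+2) hc (by omega)]
    exact G.y2 c hc i hi
  have hval : ∀ c < n, ∀ i, Nd N f g c i → f' c i = fst n N k f g tb c i :=
    fun c hc i h => (hf' c hc).2.1 i (Nd_le h) h
  refine ⟨f', g', ⟨?_, ?_, fun c hc => (hf' c hc).1, hgs, ?_, ?_, hy1, hy2⟩, hsum, ?_, ?_, hval⟩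
  · intro c hc
    rw [hval c hc 0 (Or.inl Bp_zero), fst, if_neg, G.f0 c hc]
    intro hz
    have := (Zr_prop G htz hz).2
    rw [G.f0 c hc, G.g0 c hc] at this
    omega
  · intro c hc
    have : f' c 0 = 0 := by
      rw [hval c hc 0 (Or.inl Bp_zero), fst, if_neg, G.f0 c hc]
      intro hz
      have := (Zr_prop G htz hz).2
      rw [G.f0 c hc, G.g0 c hc] at this
      omega
    simp only [hg']
    rw [this, G.f0 c hc, G.g0 c hc]; simp
  · intro c hc
    refine cmp_concave (P := Bp N f g (c+1)) Bp_zero Bp_N (hf' (c+1) hc).1 (hf' c (by omega)).1 ?_ ?_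
    · intro i hi hn
      have h1 := hy1 (c+1) hc i hi
      have h2 := Bp_affine G hc.le hi hn
      rw [hS (c+1) i hc.le (by omega), hS (c+1) (i+1) hc.le (by omega),
        hS (c+1) (i+2) hc.le (by omega)] at h1
      omega
    · intro i _ hb
      rw [hval c (by omega) i (Or.inr hb), hval (c+1) hc i (Or.inl hb)]
      exact (fst_chain G c i hc hb).1
  · intro c hc
    refine cmp_convex (P := Bp N f g (c+1)) Bp_zero Bp_N (hgs c (by omega)) (hgs (c+1) hc) ?_ ?_
    · intro i hi hn
      have h1 := hy1 c (by omega) i hi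
      have h2 := Bp_affine G hc.le hi hn
      rw [← hS (c+1) i hc.le (by omega), ← hS (c+1) (i+1) hc.le (by omega),
        ← hS (c+1) (i+2) hc.le (by omega)] at h2
      simp only [SSum_succ] at h2
      omega
    · intro i _ hb
      simp only [hg']
      rw [hval c (by omega) i (Or.inr hb), hval (c+1) hc i (Or.inl hb)]
      exact (fst_chain G c i hc hb).2
  · intro c hc hb
    have h1 := ht c hc hb
    have : f' c N = f c N - 1 := by
      rw [hval c hc N (Or.inl Bp_N), fst, if_pos (Zr.top c hc hb)]; omega
    refine ⟨this, ?_⟩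
    simp only [hg']; omega
  · intro c hc hb
    have h1 := ht' c hc hb
    have : f' c N = f c N := by
      rw [hval c hc N (Or.inl Bp_N), fst, if_neg]
      intro hz
      have := (Zr_prop G htz hz).2
      omega
    refine ⟨this, ?_⟩
    simp only [hg']; omega

lemma Zr_sub {n N : ℕ} {k : ℤ} {f₁ g₁ f₂ g₂ : ℕ → ℕ → ℤ} {tb : ℕ → Prop}
    (hB : ∀ c ≤ n, ∀ i, Bp N f₁ g₁ c i ↔ Bp N f₂ g₂ c i)
    (hM : ∀ c < n, ∀ i, Nd N f₁ g₁ c i → Mx k f₁ g₁ c i = Mx k f₂ g₂ c i ∧ Mn k f₁ g₁ c i = Mn k f₂ g₂ c i)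
    {c i : ℕ} (h : Zr n N k f₁ g₁ tb c i) : Zr n N k f₂ g₂ tb c i := by
  have hN : ∀ c < n, ∀ i, Nd N f₁ g₁ c i → Nd N f₂ g₂ c i := by
    intro c hc i h
    unfold Nd at *
    rwa [← hB c hc.le, ← hB (c+1) hc]
  have key : ∀ c i d j, Lk n N k f₁ g₁ c i d j → Lk n N k f₂ g₂ c i d j := by
    rintro c i d j (⟨rfl, h1, h2, h3, h4, h5⟩ | ⟨rfl, h1, rfl, h3, h4⟩)
    · refine Or.inl ⟨rfl, h1, h2, hN _ h1 _ h3, hN _ h1 _ h4, ?_⟩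
      rwa [(hM c h1 i h3).1, (hM c h1 j h4).1, (hM c h1 i h3).2, (hM c h1 j h4).2] at h5
    · refine Or.inr ⟨rfl, h1, rfl, (hB _ h1.le _).1 h3, ?_⟩
      rwa [(hM c (by omega) j (Or.inr h3)).1, (hM (c+1) h1 j (Or.inl h3)).2] at h4
  induction h with
  | top c hc hb => exact Zr.top c hc hb
  | step c i d j _ hl ih =>
    exact Zr.step c i d j ih (hl.imp (key _ _ _ _) (key _ _ _ _))

theorem flip_inj {n N : ℕ} {k : ℤ} {f₁ g₁ f₂ g₂ f' g' : ℕ → ℕ → ℤ} {tb : ℕ → Prop}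
    (G₁ : Good n N f₁ g₁) (G₂ : Good n N f₂ g₂)
    (s₁ : ∀ c < n, ∀ i ≤ N, f' c i + g' c i = f₁ c i + g₁ c i)
    (s₂ : ∀ c < n, ∀ i ≤ N, f' c i + g' c i = f₂ c i + g₂ c i)
    (v₁ : ∀ c < n, ∀ i, Nd N f₁ g₁ c i → f' c i = fst n N k f₁ g₁ tb c i)
    (v₂ : ∀ c < n, ∀ i, Nd N f₂ g₂ c i → f' c i = fst n N k f₂ g₂ tb c i) :
    ∀ c < n, ∀ i ≤ N, f₁ c i = f₂ c i ∧ g₁ c i = g₂ c i := by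
  have hB : ∀ c ≤ n, ∀ i, Bp N f₁ g₁ c i ↔ Bp N f₂ g₂ c i := fun c hc i =>
    Bp_congr (fun c hc i hi => by rw [← s₁ c hc i hi, ← s₂ c hc i hi]) c i hc
  have hN : ∀ c < n, ∀ i, Nd N f₁ g₁ c i ↔ Nd N f₂ g₂ c i := by
    intro c hc i
    unfold Nd
    rw [hB c hc.le, hB (c+1) hc]
  have hM : ∀ c < n, ∀ i, Nd N f₁ g₁ c i →
      Mx k f₁ g₁ c i = Mx k f₂ g₂ c i ∧ Mn k f₁ g₁ c i = Mn k f₂ g₂ c i := by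
    intro c hc i h
    have a1 := s₁ c hc i (Nd_le h)
    have a2 := s₂ c hc i (Nd_le h)
    have b1 := v₁ c hc i h
    have b2 := v₂ c hc i ((hN c hc i).1 h)
    unfold fst at b1 b2
    unfold Mx Mn
    split_ifs at b1 b2 <;> omega
  have hZ : ∀ c i, Zr n N k f₁ g₁ tb c i ↔ Zr n N k f₂ g₂ tb c i := by
    intro c i
    constructor
    · exact Zr_sub hB hM
    · exact Zr_sub (fun c hc i => (hB c hc i).symm) (fun c hc i h =>
        ⟨(hM c hc i ((hN c hc i).2 h)).1.symm, (hM c hc i ((hN c hc i).2 h)).2.symm⟩)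
  have hnode : ∀ c < n, ∀ i, Nd N f₁ g₁ c i → f₁ c i = f₂ c i := by
    intro c hc i h
    have a1 := s₁ c hc i (Nd_le h)
    have a2 := s₂ c hc i (Nd_le h)
    have b1 := v₁ c hc i h
    have b2 := v₂ c hc i ((hN c hc i).1 h)
    unfold fst at b1 b2
    by_cases hz : Zr n N k f₁ g₁ tb c i
    · rw [if_pos hz] at b1
      rw [if_pos ((hZ c i).1 hz)] at b2
      omega
    · rw [if_neg hz] at b1
      rw [if_neg (fun h => hz ((hZ c i).2 h))] at b2
      omega
  intro c hc i hi
  have le1 : f₁ c i ≤ f₂ c i := by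
    refine cmp_concave (P := Nd N f₁ g₁ c) (Or.inl Bp_zero) (Or.inl Bp_N) (G₂.fs c hc) (G₁.fs c hc) ?_ ?_ i hi
    · intro i hi hn
      exact f_concave G₂ hc hi (fun h => hn ((hN c hc _).2 (Or.inl h)))
    · intro i _ hn; rw [hnode c hc i hn]
  have le2 : f₂ c i ≤ f₁ c i := by
    refine cmp_concave (P := Nd N f₁ g₁ c) (Or.inl Bp_zero) (Or.inl Bp_N) (G₁.fs c hc) (G₂.fs c hc) ?_ ?_ i hi
    · intro i hi hn
      exact f_concave G₁ hc hi (fun h => hn (Or.inl h))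
    · intro i _ hn; rw [hnode c hc i hn]
  have a1 := s₁ c hc i hi
  have a2 := s₂ c hc i hi
  omega

end LLT

end

section
namespace LLT
variable {N n : ℕ}

/-! ### Transfer of the flip to tableaux -/

noncomputable def fz (A : Fin n → Finset (Fin N)) (c i : ℕ) : ℤ :=
  if h : c < n then F (A ⟨c, h⟩) i else 0

lemma fz_succ (A : Fin n → Finset (Fin N)) (c i : ℕ) (hc : c < n) :
    fz A c (i+1) = fz A c i + e (A ⟨c, hc⟩) i := by
  simp only [fz, dif_pos hc, F_succ]

lemma W_succ_e (A : Fin n → Finset (Fin N)) (c i : ℕ) (hc : c < n) :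
    (W A (c+1) i : ℤ) = W A c i + e (A ⟨c, hc⟩) i := by
  classical
  rw [W_succ A c hc i, e]
  split_ifs <;> simp

lemma SSum_fz (A B : Fin n → Finset (Fin N)) (c i : ℕ) (hc : c ≤ n) :
    SSum (fz A) (fz B) c (i+1) = SSum (fz A) (fz B) c i + W A c i + W B c i := by
  induction c with
  | zero => simp [SSum, W_zero]
  | succ c ih =>
    rw [SSum_succ, SSum_succ, ih (by omega), fz_succ A c i hc, fz_succ B c i hc, W_succ_e A c i hc,
      W_succ_e B c i hc]
    ring

lemma chn_iff (A : Fin n → Finset (Fin N)) :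
    Chn 1 A ↔ ∀ c, c + 1 < n → ∀ i ≤ N, fz A c i ≤ fz A (c+1) i := by
  constructor
  · intro h c hc i _
    simp only [fz, dif_pos hc, dif_pos (show c < n by omega)]
    exact h _ _ (by simp [Fin.le_def]) (by simp [Nat.mod_one]) i
  · intro h
    have key : ∀ d c, c + d < n → ∀ i ≤ N, fz A c i ≤ fz A (c+d) i := by
      intro d
      induction d with
      | zero => intro c _ i _; exact le_rfl
      | succ d ih =>
        intro c hc i hi
        exact (ih c (by omega) i hi).trans (h (c+d) (by omega) i hi)
    have key2 : ∀ s t : Fin n, s ≤ t → ∀ i ≤ N, F (A s) i ≤ F (A t) i := by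
      intro s t hst i hi
      have hst' : s.val ≤ t.val := hst
      have := key (t.val - s.val) s.val (by omega) i hi
      rw [show s.val + (t.val - s.val) = t.val by omega] at this
      simpa only [fz, dif_pos s.2, dif_pos t.2] using this
    intro s t hst _ i
    rcases le_total i N with hi | hi
    · exact key2 s t hst i hi
    · rw [F_ge _ i hi, F_ge _ i hi, ← F_N, ← F_N]
      exact key2 s t hst N le_rfl

lemma good_iff (A B : Fin n → Finset (Fin N)) :
    Good n N (fz A) (fz B) ↔ Chn 1 A ∧ Chn 1 B ∧ Yam (inter A B) := by
  constructor
  · intro G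
    refine ⟨(chn_iff A).2 G.fc, (chn_iff B).2 G.gc, ?_⟩
    intro s hs i hi
    obtain ⟨c, rfl | rfl⟩ : ∃ c, s = 2 * c ∨ s = 2 * c + 1 := ⟨s / 2, by omega⟩
    · have hc : c ≤ n := by omega
      have h := G.y2 c hc i (by omega)
      have h1 := SSum_fz A B c i hc
      have h2 := SSum_fz A B c (i+1) hc
      rw [W_inter _ _ _ _ hc, W_inter _ _ _ _ hc]
      rw [show i + 1 + 1 = i + 2 by ring] at h2
      omega
    · have hc : c < n := by omega
      have h := G.y1 c hc i (by omega)
      have h1 := SSum_fz A B c i hc.le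
      have h2 := SSum_fz A B c (i+1) hc.le
      have h3 := fz_succ A c i hc
      have h4 := fz_succ A c (i+1) hc
      have h5 := W_succ_e A c i hc
      have h6 := W_succ_e A c (i+1) hc
      rw [W_inter' _ _ _ _ hc, W_inter' _ _ _ _ hc]
      rw [show i + 1 + 1 = i + 2 by ring] at h2 h4
      omega
  · rintro ⟨hA, hB, hY⟩
    refine ⟨?_, ?_, ?_, ?_, (chn_iff A).1 hA, (chn_iff B).1 hB, ?_, ?_⟩
    · intro c hc; simp [fz, hc, F_zero]
    · intro c hc; simp [fz, hc, F_zero]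
    · intro c hc i _
      rw [fz_succ A c i hc]
      have := e_nonneg (A ⟨c, hc⟩) i
      have := e_le_one (A ⟨c, hc⟩) i
      omega
    · intro c hc i _
      rw [fz_succ B c i hc]
      have := e_nonneg (B ⟨c, hc⟩) i
      have := e_le_one (B ⟨c, hc⟩) i
      omega
    · intro c hc i hi
      have h := hY (2*c+1) (by omega) i (by omega)
      rw [W_inter' _ _ _ _ hc, W_inter' _ _ _ _ hc] at h
      have h1 := SSum_fz A B c i hc.le
      have h2 := SSum_fz A B c (i+1) hc.le
      have h3 := fz_succ A c i hc
      have h4 := fz_succ A c (i+1) hc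
      have h5 := W_succ_e A c i hc
      have h6 := W_succ_e A c (i+1) hc
      rw [show i + 1 + 1 = i + 2 by ring] at h2 h4
      omega
    · intro c hc i hi
      have h := hY (2*c) (by omega) i (by omega)
      rw [W_inter _ _ _ _ hc, W_inter _ _ _ _ hc] at h
      have h1 := SSum_fz A B c i hc
      have h2 := SSum_fz A B c (i+1) hc
      rw [show i + 1 + 1 = i + 2 by ring] at h2
      omega

lemma good_congr {f g f' g' : ℕ → ℕ → ℤ} (G : Good n N f g)
    (hf : ∀ c < n, ∀ i ≤ N, f' c i = f c i) (hg : ∀ c < n, ∀ i ≤ N, g' c i = g c i) :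
    Good n N f' g' := by
  have hS : ∀ c i, c ≤ n → i ≤ N → SSum f' g' c i = SSum f g c i :=
    SSum_congr (fun c hc i hi => by rw [hf c hc i hi, hg c hc i hi])
  refine ⟨?_, ?_, ?_, ?_, ?_, ?_, ?_, ?_⟩
  · intro c hc; rw [hf c hc 0 (by omega)]; exact G.f0 c hc
  · intro c hc; rw [hg c hc 0 (by omega)]; exact G.g0 c hc
  · intro c hc i hi; rw [hf c hc _ (by omega), hf c hc _ (by omega)]; exact G.fs c hc i hi
  · intro c hc i hi; rw [hg c hc _ (by omega), hg c hc _ (by omega)]; exact G.gs c hc i hi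
  · intro c hc i hi; rw [hf c (by omega) _ hi, hf (c+1) (by omega) _ hi]; exact G.fc c hc i hi
  · intro c hc i hi; rw [hg c (by omega) _ hi, hg (c+1) (by omega) _ hi]; exact G.gc c hc i hi
  · intro c hc i hi
    rw [hS c i hc.le (by omega), hS c (i+1) hc.le (by omega), hS c (i+2) hc.le (by omega),
      hf c hc i (by omega), hf c hc (i+1) (by omega), hf c hc (i+2) (by omega)]
    exact G.y1 c hc i hi
  · intro c hc i hi
    rw [hS c i hc (by omega), hS c (i+1) hc (by omega), hS c (i+2) hc (by omega)]
    exact G.y2 c hc i hi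

lemma realize (f : ℕ → ℕ → ℤ) (f0 : ∀ c < n, f c 0 = 0)
    (fs : ∀ c < n, ∀ i < N, 0 ≤ f c (i+1) - f c i ∧ f c (i+1) - f c i ≤ 1) :
    ∃ A : Fin n → Finset (Fin N), ∀ c < n, ∀ i ≤ N, fz A c i = f c i := by
  classical
  refine ⟨fun c => univ.filter fun x => f c (x+1) - f c x = 1, ?_⟩
  intro c hc i hi
  induction i with
  | zero => rw [f0 c hc]; simp [fz, hc, F_zero]
  | succ i ih =>
    rw [fz_succ _ c i hc, ih (by omega)]
    have h := fs c hc i hi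
    by_cases h1 : f c (i+1) - f c i = 1
    · rw [e_eq_one.2 (by exact ⟨hi, by simpa using h1⟩)]; omega
    · rw [e_eq_zero.2 (by rintro ⟨_, h2⟩; exact h1 (by simpa using h2))]; omega

lemma fz_inj {A B : Fin n → Finset (Fin N)} (h : ∀ c < n, ∀ i ≤ N, fz A c i = fz B c i) : A = B := by
  funext c
  apply F_ext
  intro i hi
  have := h c c.2 i hi
  simpa only [fz, dif_pos c.2] using this

lemma fz_N (A : Fin n → Finset (Fin N)) (c : Fin n) : fz A c N = (A c).card := by
  simp only [fz, dif_pos c.2, F_N]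

/-- The basic two-row exchange inequality. -/
theorem exchange (α β α' β' : Fin n → ℕ) (K : ℕ) (hK : 1 ≤ K)
    (h : ∀ c, α c ≤ β c + K)
    (h1 : ∀ c, α c = β c + K → α' c + 1 = α c ∧ β' c = β c + 1)
    (h2 : ∀ c, α c ≠ β c + K → α' c = α c ∧ β' c = β c) :
    tq N 1 α' * tq N 1 β' - tq N 1 α * tq N 1 β ∈ SP N := by
  classical
  rw [tq_mul, tq_mul, tq_eq_sum 2 (by omega) le_rfl, tq_eq_sum 2 (by omega) le_rfl]
  set Y := (base N 2 (inter α β)).filter Yam with hYd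
  set Y' := (base N 2 (inter α' β')).filter Yam with hYd'
  set k : ℤ := (K : ℤ) - 1 with hk
  set tb : ℕ → Prop := fun c => ∃ hc : c < n, α ⟨c, hc⟩ = β ⟨c, hc⟩ + K with htb
  set ea : (Fin (n*2) → Finset (Fin N)) → ℕ → ℕ → ℤ :=
    fun D => fz (fun c : Fin n => D ⟨2*c, by omega⟩) with hea
  set eb : (Fin (n*2) → Finset (Fin N)) → ℕ → ℕ → ℤ :=
    fun D => fz (fun c : Fin n => D ⟨2*c+1, by omega⟩) with heb
  have memY : ∀ (γ δ : Fin n → ℕ) (D : Fin (n*2) → Finset (Fin N)),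
      D ∈ (base N 2 (inter γ δ)).filter Yam ↔ Good n N (ea D) (eb D) ∧
        ∀ c : Fin n, ea D c N = γ c ∧ eb D c N = δ c := by
    intro γ δ D
    have hD := inter_surj (n := n) D
    rw [mem_filter]
    conv_lhs => rw [← hD]
    rw [base_inter, mem_base, mem_base, hea, heb]
    simp only [good_iff, fz_N, Nat.cast_inj]
    constructor
    · rintro ⟨⟨⟨a, b⟩, c, d⟩, e⟩
      exact ⟨⟨a, c, e⟩, fun x => ⟨b x, d x⟩⟩
    · rintro ⟨⟨a, c, e⟩, b⟩
      exact ⟨⟨⟨a, fun x => (b x).1⟩, c, fun x => (b x).2⟩, e⟩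
  have ex : ∀ D, ∃ D', D ∈ Y → D' ∈ Y' ∧
      (∀ c < n, ∀ i ≤ N, ea D' c i + eb D' c i = ea D c i + eb D c i) ∧
      ∀ c < n, ∀ i, Nd N (ea D) (eb D) c i → ea D' c i = fst n N k (ea D) (eb D) tb c i := by
    intro D
    by_cases hD : D ∈ Y
    swap
    · exact ⟨D, fun h => absurd h hD⟩
    obtain ⟨G, hl⟩ := (memY α β D).1 hD
    obtain ⟨f', g', G', hs, ht1, ht2, hv⟩ := flip_exists (k := k) (tb := tb) (by omega) G
      (by rintro c hc ⟨_, hh⟩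
          have := hl ⟨c, hc⟩
          simp only at this
          rw [this.1, this.2, hh]; push_cast; omega)
      (by intro c hc hh
          have := hl ⟨c, hc⟩
          simp only at this
          rw [this.1, this.2]
          have h3 := h ⟨c, hc⟩
          have h4 : α ⟨c, hc⟩ ≠ β ⟨c, hc⟩ + K := fun h5 => hh ⟨hc, h5⟩
          omega)
    obtain ⟨A', hA'⟩ := realize f' G'.f0 G'.fs
    obtain ⟨B', hB'⟩ := realize g' G'.g0 G'.gs
    have ea' : ea (inter A' B') = fz A' := by
      simp only [hea]; congr 1; funext c; exact inter_even _ _ _ c.2 _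
    have eb' : eb (inter A' B') = fz B' := by
      simp only [heb]; congr 1; funext c; exact inter_odd _ _ _ c.2 _
    refine ⟨inter A' B', fun _ => ⟨?_, ?_, ?_⟩⟩
    · rw [hYd', memY, ea', eb']
      refine ⟨good_congr G' hA' hB', fun c => ?_⟩
      rw [hA' c c.2 N le_rfl, hB' c c.2 N le_rfl]
      have hlc := hl c
      by_cases hc : α c = β c + K
      · have := ht1 c c.2 ⟨c.2, hc⟩
        have := h1 c hc
        omega
      · have := ht2 c c.2 (by rintro ⟨_, h5⟩; exact hc h5)
        have := h2 c hc
        omega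
    · intro c hc i hi
      rw [ea', eb', hA' c hc i hi, hB' c hc i hi, hs c hc i hi]
    · intro c hc i hi
      rw [ea', hA' c hc i (Nd_le hi), hv c hc i hi]
  choose Φ hΦ using ex
  have inj : Set.InjOn Φ Y := by
    intro D hD E hE hDE
    obtain ⟨_, s1, v1⟩ := hΦ D hD
    obtain ⟨_, s2, v2⟩ := hΦ E hE
    rw [← hDE] at s2 v2
    have := flip_inj ((memY α β D).1 hD).1 ((memY α β E).1 hE).1 s1 s2 v1 v2
    have hA := fz_inj (fun c hc i hi => (this c hc i hi).1)
    have hB := fz_inj (fun c hc i hi => (this c hc i hi).2)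
    rw [← inter_surj (n := n) D, ← inter_surj (n := n) E, hA, hB]
  have sub : Y.image Φ ⊆ Y' := by
    intro D hD
    obtain ⟨E, hE, rfl⟩ := mem_image.1 hD
    exact (hΦ E hE).1
  have hw : ∀ D ∈ Y, ∀ i, W (Φ D) (n*2) i = W D (n*2) i := by
    intro D hD i
    rcases le_or_gt N i with hi | hi
    · rw [W_beyond _ _ _ hi, W_beyond _ _ _ hi]
    obtain ⟨_, s1, _⟩ := hΦ D hD
    have hS := SSum_congr s1
    have e1 : ∀ E : Fin (n*2) → Finset (Fin N), (W E (n*2) i : ℤ) =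
        SSum (ea E) (eb E) n (i+1) - SSum (ea E) (eb E) n i := by
      intro E
      have := SSum_fz (fun c : Fin n => E ⟨2*c, by omega⟩) (fun c : Fin n => E ⟨2*c+1, by omega⟩) n i le_rfl
      have h3 := W_inter (fun c : Fin n => E ⟨2*c, by omega⟩) (fun c : Fin n => E ⟨2*c+1, by omega⟩) n i le_rfl
      rw [inter_surj, mul_comm 2 n] at h3
      simp only [hea, heb]
      rw [this, h3]; push_cast; ring
    have := e1 (Φ D)
    rw [hS n _ le_rfl (by omega), hS n _ le_rfl (by omega), ← e1 D] at this
    exact_mod_cast this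
  rw [← sum_sdiff sub, sum_image inj]
  have : ∑ D ∈ Y, skewSchur N N (fun i => W (Φ D) (n*2) i) (fun _ => 0) =
      ∑ D ∈ Y, skewSchur N N (fun i => W D (n*2) i) (fun _ => 0) := by
    apply sum_congr rfl
    intro D hD
    congr 1
    funext i
    exact hw D hD i
  rw [this, add_sub_cancel_right]
  apply AddSubmonoid.sum_mem
  intro D hD
  exact schur_W_mem (mem_filter.1 (mem_sdiff.1 hD).1).2

end LLT

end

section
namespace LLT
variable {N T n : ℕ}

/-! ### Balancing -/

lemma prod_pair {M : Type*} [CommMonoid M] (g : Fin n → M) {a b : Fin n} (hab : a ≠ b) :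
    ∏ i, g i = g a * g b * ∏ i ∈ (univ.erase a).erase b, g i := by
  rw [← mul_prod_erase univ g (mem_univ a), ← mul_prod_erase (univ.erase a) g (a := b)
    (mem_erase.2 ⟨hab.symm, mem_univ b⟩), mul_assoc]

lemma sum_pair' {M : Type*} [AddCommMonoid M] (g : Fin n → M) {a b : Fin n} (hab : a ≠ b) :
    ∑ i, g i = g a + g b + ∑ i ∈ (univ.erase a).erase b, g i := by
  rw [← add_sum_erase univ g (mem_univ a), ← add_sum_erase (univ.erase a) g (a := b)
    (mem_erase.2 ⟨hab.symm, mem_univ b⟩), add_assoc]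

lemma SP_one : (1 : MvPolynomial (Fin N) ℤ) ∈ SP N := by
  apply AddSubmonoid.subset_closure
  refine ⟨0, fun _ => 0, fun _ _ _ => le_rfl, fun _ _ => rfl, ?_⟩
  simp [skewSchur]

lemma SP_prod {ι : Type*} (s : Finset ι) (g : ι → MvPolynomial (Fin N) ℤ) (h : ∀ i ∈ s, g i ∈ SP N) :
    ∏ i ∈ s, g i ∈ SP N := by
  classical
  induction s using Finset.induction_on with
  | empty => simpa using SP_one
  | insert a s ha ih =>
    rw [prod_insert ha]
    exact SP_mul (h a (mem_insert_self _ _)) (ih fun i hi => h i (mem_insert_of_mem hi))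

lemma tq_zero : tq N 1 (fun _ : Fin T => 0) = 1 := by
  have := schur_eq_tq (N := N) (T := T) 0 (fun _ => 0) (fun _ _ _ => le_rfl) (fun _ _ => rfl) (by simp)
  have h2 : conj T 0 (fun _ => 0) = fun _ : Fin T => 0 := by funext s; simp [conj]
  rw [h2] at this
  rw [← this]
  simp [skewSchur]

/-- The potential function. -/
def pot (Λ : Fin n → Fin T → ℕ) : ℤ := ∑ c, ∑ i, ((n : ℤ) * (Λ i c : ℤ)^2 + i * (Λ i c : ℤ))

lemma progress (Λ : Fin n → Fin T → ℕ) (a b : Fin n) (hab : a ≠ b) (c0 : Fin T)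
    (hc0 : Λ b c0 + 1 ≤ Λ a c0) (hc1 : a < b → Λ b c0 + 2 ≤ Λ a c0) :
    ∃ Λ' : Fin n → Fin T → ℕ, (∀ c, ∑ i, Λ' i c = ∑ i, Λ i c) ∧ pot Λ' < pot Λ ∧
      ∏ i, tq N 1 (Λ' i) - ∏ i, tq N 1 (Λ i) ∈ SP N := by
  classical
  obtain ⟨cm, -, hcm⟩ := exists_max_image (univ : Finset (Fin T)) (fun c => (Λ a c : ℤ) - Λ b c) ⟨c0, mem_univ _⟩
  obtain ⟨K, hK⟩ : ∃ K : ℕ, Λ a cm = Λ b cm + K := by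
    have := hcm c0 (mem_univ _)
    exact ⟨Λ a cm - Λ b cm, by omega⟩
  have hK1 : 1 ≤ K := by have := hcm c0 (mem_univ _); omega
  have hK2 : a < b → 2 ≤ K := fun h => by have := hcm c0 (mem_univ _); have := hc1 h; omega
  have hle : ∀ c, Λ a c ≤ Λ b c + K := fun c => by have := hcm c (mem_univ _); omega
  set α' : Fin T → ℕ := fun c => if Λ a c = Λ b c + K then Λ a c - 1 else Λ a c with hα
  set β' : Fin T → ℕ := fun c => if Λ a c = Λ b c + K then Λ b c + 1 else Λ b c with hβ
  set Λ' : Fin n → Fin T → ℕ := fun i => if i = a then α' else if i = b then β' else Λ i with hΛ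
  have ea : Λ' a = α' := by simp [hΛ]
  have eb : Λ' b = β' := by simp [hΛ, hab.symm]
  have eo : ∀ i ∈ (univ.erase a).erase b, Λ' i = Λ i := by
    intro i hi
    simp only [mem_erase] at hi
    simp [hΛ, hi.1, hi.2.1]
  refine ⟨Λ', ?_, ?_, ?_⟩
  · intro c
    rw [sum_pair' _ hab, sum_pair' (fun i => Λ i c) hab, ea, eb]
    congr 1
    · simp only [hα, hβ]
      split_ifs <;> omega
    · exact sum_congr rfl fun i hi => by rw [eo i hi]
  · unfold pot
    have key : ∀ c, ∑ i, ((n : ℤ) * (Λ' i c : ℤ)^2 + i * (Λ' i c : ℤ)) ≤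
        ∑ i, ((n : ℤ) * (Λ i c : ℤ)^2 + i * (Λ i c : ℤ)) ∧ (Λ a c = Λ b c + K →
        ∑ i, ((n : ℤ) * (Λ' i c : ℤ)^2 + i * (Λ' i c : ℤ)) <
        ∑ i, ((n : ℤ) * (Λ i c : ℤ)^2 + i * (Λ i c : ℤ))) := by
      intro c
      rw [sum_pair' _ hab, sum_pair' (fun i : Fin n => ((n : ℤ) * (Λ i c : ℤ)^2 + i * (Λ i c : ℤ))) hab, ea, eb]
      have : ∑ i ∈ (univ.erase a).erase b, ((n : ℤ) * (Λ' i c : ℤ)^2 + i * (Λ' i c : ℤ)) =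
          ∑ i ∈ (univ.erase a).erase b, ((n : ℤ) * (Λ i c : ℤ)^2 + i * (Λ i c : ℤ)) :=
        sum_congr rfl fun i hi => by rw [eo i hi]
      rw [this]
      by_cases hc : Λ a c = Λ b c + K
      · have hlt : ((n : ℤ) * (α' c : ℤ)^2 + a * (α' c : ℤ)) + ((n : ℤ) * (β' c : ℤ)^2 + b * (β' c : ℤ)) <
            ((n : ℤ) * (Λ a c : ℤ)^2 + a * (Λ a c : ℤ)) + ((n : ℤ) * (Λ b c : ℤ)^2 + b * (Λ b c : ℤ)) := by
          have h1 : (α' c : ℤ) = Λ b c + K - 1 := by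
            simp only [hα, if_pos hc]; omega
          have h2 : (β' c : ℤ) = Λ b c + 1 := by
            simp only [hβ, if_pos hc]; push_cast; rfl
          have h3 : (Λ a c : ℤ) = Λ b c + K := by exact_mod_cast hc
          rw [h1, h2, h3]
          have hd : (n : ℤ) * (2 * K - 2) + a - b > 0 := by
            have han := a.2
            have hbn := b.2
            rcases lt_or_gt_of_ne hab with h | h
            · have := hK2 h
              have : (n : ℤ) * 2 ≤ n * (2 * K - 2) := mul_le_mul_of_nonneg_left (by omega) (by omega)
              omega
            · have : (0 : ℤ) ≤ n * (2 * K - 2) := mul_nonneg (by omega) (by omega)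
              have h' : b.val < a.val := h
              omega
          nlinarith [hd]
        constructor
        · linarith
        · intro _; linarith
      · have h1 : α' c = Λ a c := by simp only [hα, if_neg hc]
        have h2 : β' c = Λ b c := by simp only [hβ, if_neg hc]
        rw [h1, h2]
        exact ⟨le_rfl, fun h => absurd h hc⟩
    exact sum_lt_sum (fun c _ => (key c).1) ⟨cm, mem_univ _, (key cm).2 hK⟩
  · rw [prod_pair _ hab, prod_pair (fun i => tq N 1 (Λ i)) hab, ea, eb,
      prod_congr rfl (fun i hi => by rw [eo i hi] :
        ∀ i ∈ (univ.erase a).erase b, tq N 1 (Λ' i) = tq N 1 (Λ i)), ← sub_mul]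
    apply SP_mul
    · apply exchange _ _ _ _ K hK1 hle
      · intro c hc
        have hz : 1 ≤ Λ a c := by omega
        simp only [hα, hβ, if_pos hc]
        exact ⟨Nat.sub_add_cancel hz, trivial⟩
      · intro c hc
        simp only [hα, hβ, if_neg hc, and_self]
    · exact SP_prod _ _ fun i _ => tq_mem 1 le_rfl (by omega) _

lemma pot_nonneg (Λ : Fin n → Fin T → ℕ) : 0 ≤ pot Λ := by
  unfold pot; positivity

lemma balanced_eq (x : Fin n → ℕ) (h : ∀ a b : Fin n, a < b → x b ≤ x a ∧ x a ≤ x b + 1) (i : Fin n) :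
    x i = (∑ j, x j + n - 1 - i) / n := by
  have hi := i.2
  have u : ∑ j, x j ≤ ∑ j : Fin n, (x i + if j.val < i.val then 1 else 0) := by
    apply sum_le_sum
    intro j _
    rcases lt_trichotomy j i with hj | hj | hj
    · have := h j i hj
      have hj' : j.val < i.val := hj
      rw [if_pos hj']; omega
    · subst hj; simp
    · have := h i j hj; omega
  have l : ∑ j : Fin n, (x i + if j.val < i.val + 1 then 1 else 0) ≤ ∑ j : Fin n, (x j + 1) := by
    apply sum_le_sum
    intro j _
    rcases lt_trichotomy j i with hj | hj | hj
    · have := h j i hj; split_ifs <;> omega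
    · subst hj; simp
    · have := h i j hj
      have hj' : i.val < j.val := hj
      rw [if_neg (by omega)]; omega
  have cnt : ∀ r ≤ n, ∑ j : Fin n, (if j.val < r then 1 else 0) = r := by
    intro r hr
    rw [Fin.sum_univ_eq_sum_range (fun j => if j < r then 1 else 0) n, ← sum_filter,
      show (range n).filter (fun j => j < r) = range r by ext; simp; omega]
    simp
  rw [sum_add_distrib, cnt _ (by omega)] at u l
  rw [sum_add_distrib] at l
  simp only [sum_const, card_univ, Fintype.card_fin, smul_eq_mul, mul_one] at u l
  symm
  rw [Nat.div_eq_iff (by omega)]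
  rw [mul_comm n (x i)] at u l
  constructor <;> omega

theorem balance (Λ : Fin n → Fin T → ℕ) :
    ∏ i : Fin n, tq N 1 (fun c => (∑ j, Λ j c + n - 1 - i) / n) - ∏ i, tq N 1 (Λ i) ∈ SP N := by
  induction hp : (pot Λ).toNat using Nat.strong_induction_on generalizing Λ with
  | _ p ih =>
  by_cases hb : ∀ c, ∀ a b : Fin n, a < b → Λ b c ≤ Λ a c ∧ Λ a c ≤ Λ b c + 1
  · have : ∀ i : Fin n, (fun c => (∑ j, Λ j c + n - 1 - i) / n) = Λ i := by
      intro i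
      funext c
      exact (balanced_eq (fun j => Λ j c) (hb c) i).symm
    simp only [this, sub_self]
    exact zero_mem _
  · push Not at hb
    obtain ⟨c, a, b, hab, h⟩ := hb
    obtain ⟨Λ', h1, h2, h3⟩ : ∃ Λ' : Fin n → Fin T → ℕ, (∀ c, ∑ i, Λ' i c = ∑ i, Λ i c) ∧ pot Λ' < pot Λ ∧
      ∏ i, tq N 1 (Λ' i) - ∏ i, tq N 1 (Λ i) ∈ SP N := by
      by_cases h4 : Λ b c ≤ Λ a c
      · have := h h4
        exact progress Λ a b hab.ne c (by omega) (by omega)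
      · exact progress Λ b a hab.ne' c (by omega) (fun h => absurd h (by omega))
    have n1 := pot_nonneg Λ'
    have := ih (pot Λ').toNat (by omega) Λ' rfl
    simp only [h1] at this
    have := add_mem this h3
    rwa [sub_add_sub_cancel] at this

lemma hermite (m L : ℕ) (hm : 1 ≤ m) : ∑ i ∈ range m, (L + i) / m = L := by
  induction L with
  | zero =>
    apply sum_eq_zero
    intro i hi
    rw [zero_add]
    exact Nat.div_eq_of_lt (mem_range.1 hi)
  | succ L ih =>
    have h1 := sum_range_succ (fun i => (L + i) / m) m
    have h2 := sum_range_succ' (fun i => (L + i) / m) m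
    have h3 : (L + m) / m = L / m + 1 := Nat.add_div_right L hm
    have h4 : ∑ i ∈ range m, (L + 1 + i) / m = ∑ i ∈ range m, (L + (i + 1)) / m :=
      sum_congr rfl fun i _ => by congr 1; ring
    simp only [add_zero] at h2
    omega

lemma hermite' (m L : ℕ) (hm : 1 ≤ m) : ∑ i ∈ range m, (L + m - 1 - i) / m = L := by
  conv_rhs => rw [← hermite m L hm]
  rw [← sum_range_reflect (fun i => (L + i) / m)]
  apply sum_congr rfl
  intro i hi
  rw [mem_range] at hi
  congr 1
  omega

lemma conj_sub (k : ℕ) (lam : ℕ → ℕ) (hlam : Antitone lam) (hlamk : ∀ j, k ≤ j → lam j = 0)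
    (m : ℕ) (i : ℕ) (hi : i < m) (s : Fin T) :
    conj T k (fun j => lam (i + j * m)) s = (conj T k lam s + m - 1 - i) / m := by
  have key : ∀ j, j < conj T k (fun j => lam (i + j * m)) s ↔ j < (conj T k lam s + m - 1 - i) / m := by
    intro j
    rw [lt_conj, ← lt_conj k lam hlam hlamk, Nat.lt_iff_add_one_le, Nat.lt_iff_add_one_le, Nat.le_div_iff_mul_le (by omega), add_mul]
    · constructor <;> intro h <;> omega
    · intro x y hxy
      exact hlam (by gcongr)
    · intro j hj
      apply hlamk
      have : j * 1 ≤ j * m := Nat.mul_le_mul_left j (by omega)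
      omega
  apply le_antisymm
  · by_contra h; push Not at h; exact lt_irrefl _ ((key _).1 h)
  · by_contra h; push Not at h; exact lt_irrefl _ ((key _).2 h)

lemma schur_sub (k : ℕ) (lam : ℕ → ℕ) (hlam : Antitone lam) (hlamk : ∀ j, k ≤ j → lam j = 0)
    (m : ℕ) (i : ℕ) (hi : i < m) :
    skewSchur N k (fun j => lam (i + j * m)) (fun _ => 0) =
      tq N 1 (fun s : Fin (lam 0) => (conj (lam 0) k lam s + m - 1 - i) / m) := by
  rw [schur_eq_tq (T := lam 0)]
  · congr 1
    funext s
    exact conj_sub k lam hlam hlamk m i hi s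
  · intro x y hxy
    exact hlam (by gcongr)
  · intro j hj
    apply hlamk
    have : j * 1 ≤ j * m := Nat.mul_le_mul_left j (by omega)
    omega
  · exact hlam (by omega)

theorem main (m n : ℕ) (hm : 1 ≤ m) (hmn : m ≤ n)
    (k : ℕ) (lam : ℕ → ℕ) (hlam : Antitone lam) (hlamk : ∀ j, k ≤ j → lam j = 0)
    (N : ℕ) :
      (∏ i : Fin n, skewSchur N k (fun j => lam (i + j * n)) (fun _ => 0)
        - ∏ i : Fin m, skewSchur N k (fun j => lam (i + j * m)) (fun _ => 0)) ∈ SP N := by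
  have hs : ∀ c : Fin (lam 0), ∑ i : Fin n, (if i.val < m then (conj (lam 0) k lam c + m - 1 - i) / m else 0) =
      conj (lam 0) k lam c := by
    intro c
    rw [Fin.sum_univ_eq_sum_range (fun i => if i < m then (conj (lam 0) k lam c + m - 1 - i) / m else 0) n,
      ← sum_filter, show (range n).filter (fun j => j < m) = range m by ext; simp; omega, hermite' _ _ hm]
  have hb := balance (N := N) (n := n) (fun (i : Fin n) (c : Fin (lam 0)) =>
    if i.val < m then (conj (lam 0) k lam c + m - 1 - i) / m else 0)
  simp only [hs] at hb
  have h1 : ∏ i : Fin n, skewSchur N k (fun j => lam (i + j * n)) (fun _ => 0) =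
      ∏ i : Fin n, tq N 1 (fun c : Fin (lam 0) => (conj (lam 0) k lam c + n - 1 - i) / n) :=
    prod_congr rfl fun i _ => schur_sub k lam hlam hlamk n i i.2
  have h2 : ∏ i : Fin m, skewSchur N k (fun j => lam (i + j * m)) (fun _ => 0) =
      ∏ i : Fin n, tq N 1 (fun c : Fin (lam 0) => if i.val < m then (conj (lam 0) k lam c + m - 1 - i) / m else 0) := by
    rw [Fin.prod_univ_eq_prod_range (fun i => tq N 1 (fun c : Fin (lam 0) =>
        if i < m then (conj (lam 0) k lam c + m - 1 - i) / m else 0)) n,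
      Fin.prod_univ_eq_prod_range (fun i => skewSchur N k (fun j => lam (i + j * m)) (fun _ => 0)) m,
      ← prod_subset (s₁ := range m) (s₂ := range n)]
    · apply prod_congr rfl
      intro i hi
      rw [mem_range] at hi
      rw [schur_sub k lam hlam hlamk m i hi]
      simp only [if_pos hi]
    · intro i; simp only [mem_range]; omega
    · intro i _ hi
      rw [mem_range] at hi
      simp only [if_neg hi]
      exact tq_zero
  rw [h1, h2]
  exact hb

end LLT

end

end

/-- **Lascoux–Leclerc–Thibon conjecture (case q = 1).** For `1 ≤ m ≤ n` and a
partition `λ` (with at most `k` parts), `∏_{i=1}^n s_{λ^{[i,n]}} ≥_s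
∏_{i=1}^m s_{λ^{[i,m]}}`, where `λ^{[i,n]} = (λ_i, λ_{i+n}, λ_{i+2n}, …)`.
Here `i : Fin n` is the 0-indexed version of the 1-indexed `i`, so that
`λ^{[i,n]}` is the 0-indexed partition `j ↦ λ (i + j * n)`. -/
theorem lascoux_leclerc_thibon_conjecture (m n : ℕ) (hm : 1 ≤ m) (hmn : m ≤ n)
    (k : ℕ) (lam : ℕ → ℕ) (hlam : Antitone lam) (hlamk : ∀ j, k ≤ j → lam j = 0)
    (N : ℕ) :
    IsSchurNonneg N
      (∏ i : Fin n, skewSchur N k (fun j => lam (i + j * n)) (fun _ => 0)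
        - ∏ i : Fin m, skewSchur N k (fun j => lam (i + j * m)) (fun _ => 0)) := by
  exact LLT.isSchurNonneg_of_mem (LLT.main m n hm hmn k lam hlam hlamk N)
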